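/- arXiv:1106.0200 — 2 statements merged into one kernel-verified Lean document; each statement's English description precedes it below -/
import Mathlib

section
/- Let Z be a well-behaved percolation in the hyperbolic plane H² with α-value α ≥ 1, and let o ∈ H² be fixed. Then, almost surely, there is no point z on the ideal boundary ∂H² such that the geodesic ray [o, z) is entirely contained in Z; equivalently the visibility set 𝔙 is empty a.s. -/
open MeasureTheory ENNReal Set ProbabilityTheory

/-- The Effros-type σ-algebra on the closed subsets of a topological space,
generated by the hitting events `{s | s ∩ K ≠ ∅}`, `K` compact. -/
def effrosSigma (X : Type*) [TopologicalSpace X] : MeasurableSpace (Set X) :=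
  MeasurableSpace.generateFrom {T | ∃ K : Set X, IsCompact K ∧ T = {s | (s ∩ K).Nonempty}}

namespace Vis

/-- Hyperboloid coordinates on the upper half plane. -/
noncomputable def cA (z : UpperHalfPlane) : ℝ := (z.re ^ 2 + z.im ^ 2 - 1) / (2 * z.im)
noncomputable def cB (z : UpperHalfPlane) : ℝ := z.re / z.im
noncomputable def cX (z : UpperHalfPlane) : ℝ := (z.re ^ 2 + z.im ^ 2 + 1) / (2 * z.im)

lemma cX_sq (z : UpperHalfPlane) : cX z ^ 2 = 1 + cA z ^ 2 + cB z ^ 2 := by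
  have h := z.im_pos.ne'
  unfold cX cA cB
  field_simp
  ring

lemma cX_pos (z : UpperHalfPlane) : 0 < cX z := by
  have h := z.im_pos
  unfold cX
  positivity

lemma cosh_dist_coord (z w : UpperHalfPlane) :
    Real.cosh (dist z w) = cX z * cX w - cA z * cA w - cB z * cB w := by
  have h := z.im_pos.ne'
  have h' := w.im_pos.ne'
  rw [UpperHalfPlane.cosh_dist, Complex.dist_eq_re_im,
    Real.sq_sqrt (by positivity)]
  simp only [UpperHalfPlane.coe_re, UpperHalfPlane.coe_im]
  unfold cX cA cB
  field_simp
  ring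

lemma cX_eq (z : UpperHalfPlane) : cX z = Real.sqrt (1 + cA z ^ 2 + cB z ^ 2) := by
  rw [← cX_sq, Real.sqrt_sq (cX_pos z).le]

lemma inv_im (z : UpperHalfPlane) : cX z - cA z = 1 / z.im := by
  have h := z.im_pos.ne'
  unfold cX cA
  field_simp
  ring

lemma coord_ext {z w : UpperHalfPlane} (hA : cA z = cA w) (hB : cB z = cB w) : z = w := by
  have hX : cX z = cX w := by rw [cX_eq, cX_eq, hA, hB]
  have him : z.im = w.im := by
    have h1 := inv_im z
    have h2 := inv_im w
    rw [hX, hA, h2] at h1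
    have := z.im_pos
    have := w.im_pos
    field_simp at h1
    linarith
  refine UpperHalfPlane.ext_re_im ?_ him
  unfold cB at hB
  rw [him] at hB
  have := w.im_pos.ne'
  field_simp at hB
  exact hB

lemma sqrt_sub_pos (a b : ℝ) : 0 < Real.sqrt (1 + a ^ 2 + b ^ 2) - a := by
  have : a < Real.sqrt (1 + a ^ 2 + b ^ 2) := by
    apply Real.lt_sqrt_of_sq_lt
    nlinarith [sq_nonneg b]
  linarith

/-- The point with prescribed coordinates. -/
noncomputable def ofAB (a b : ℝ) : UpperHalfPlane :=
  UpperHalfPlane.mk ⟨b / (Real.sqrt (1 + a ^ 2 + b ^ 2) - a),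
    1 / (Real.sqrt (1 + a ^ 2 + b ^ 2) - a)⟩ (by
      have := sqrt_sub_pos a b
      positivity)

lemma ofAB_re (a b : ℝ) : (ofAB a b).re = b / (Real.sqrt (1 + a ^ 2 + b ^ 2) - a) := rfl
lemma ofAB_im (a b : ℝ) : (ofAB a b).im = 1 / (Real.sqrt (1 + a ^ 2 + b ^ 2) - a) := rfl

lemma cA_ofAB (a b : ℝ) : cA (ofAB a b) = a := by
  have h := (sqrt_sub_pos a b)
  unfold cA
  rw [ofAB_re, ofAB_im]
  have h2 : Real.sqrt (1 + a ^ 2 + b ^ 2) ^ 2 = 1 + a ^ 2 + b ^ 2 := Real.sq_sqrt (by positivity)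
  generalize Real.sqrt (1 + a ^ 2 + b ^ 2) = q at *
  have := h.ne'
  field_simp
  nlinarith

lemma cB_ofAB (a b : ℝ) : cB (ofAB a b) = b := by
  have h := (sqrt_sub_pos a b).ne'
  unfold cB
  rw [ofAB_re, ofAB_im]
  field_simp

lemma ofAB_coord (z : UpperHalfPlane) : ofAB (cA z) (cB z) = z :=
  coord_ext (cA_ofAB _ _) (cB_ofAB _ _)

/-- Rotation about `i`. -/
noncomputable def rot (φ : ℝ) : UpperHalfPlane ≃ᵢ UpperHalfPlane where
  toFun z := ofAB (Real.cos φ * cA z - Real.sin φ * cB z) (Real.sin φ * cA z + Real.cos φ * cB z)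
  invFun z := ofAB (Real.cos φ * cA z + Real.sin φ * cB z) (- Real.sin φ * cA z + Real.cos φ * cB z)
  left_inv z := by
    have := Real.sin_sq_add_cos_sq φ
    apply coord_ext
    · rw [cA_ofAB, cA_ofAB, cB_ofAB]; linear_combination cA z * this
    · rw [cB_ofAB, cA_ofAB, cB_ofAB]; linear_combination cB z * this
  right_inv z := by
    have := Real.sin_sq_add_cos_sq φ
    apply coord_ext
    · rw [cA_ofAB, cA_ofAB, cB_ofAB]; linear_combination cA z * this
    · rw [cB_ofAB, cA_ofAB, cB_ofAB]; linear_combination cB z * this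
  isometry_toFun := by
    apply Isometry.of_dist_eq
    intro z w
    have hs := Real.sin_sq_add_cos_sq φ
    have hX : ∀ z, cX (ofAB (Real.cos φ * cA z - Real.sin φ * cB z)
        (Real.sin φ * cA z + Real.cos φ * cB z)) = cX z := by
      intro z
      rw [cX_eq, cX_eq, cA_ofAB, cB_ofAB]
      congr 1
      linear_combination (cA z ^ 2 + cB z ^ 2) * hs
    have : Real.cosh (dist (ofAB (Real.cos φ * cA z - Real.sin φ * cB z)
        (Real.sin φ * cA z + Real.cos φ * cB z)) (ofAB (Real.cos φ * cA w - Real.sin φ * cB w)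
        (Real.sin φ * cA w + Real.cos φ * cB w))) = Real.cosh (dist z w) := by
      rw [cosh_dist_coord, cosh_dist_coord, hX, hX, cA_ofAB, cB_ofAB, cA_ofAB, cB_ofAB]
      linear_combination -(cA z * cA w + cB z * cB w) * hs
    have h := Real.cosh_strictMonoOn.injOn (x₁ := dist _ _) dist_nonneg dist_nonneg this
    exact h

lemma cA_rot (φ : ℝ) (z) : cA (rot φ z) = Real.cos φ * cA z - Real.sin φ * cB z := cA_ofAB _ _
lemma cB_rot (φ : ℝ) (z) : cB (rot φ z) = Real.sin φ * cA z + Real.cos φ * cB z := cB_ofAB _ _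

lemma rot_add (φ ψ : ℝ) (z) : rot (φ + ψ) z = rot φ (rot ψ z) := by
  apply coord_ext
  · simp only [cA_rot, cB_rot, Real.cos_add, Real.sin_add]; ring
  · simp only [cA_rot, cB_rot, Real.cos_add, Real.sin_add]; ring

lemma cA_I : cA UpperHalfPlane.I = 0 := by simp [cA]
lemma cB_I : cB UpperHalfPlane.I = 0 := by simp [cB]
lemma cX_I : cX UpperHalfPlane.I = 1 := by norm_num [cX]

lemma rot_I (φ : ℝ) : rot φ UpperHalfPlane.I = UpperHalfPlane.I := by
  apply coord_ext
  · simp [cA_rot, cA_I, cB_I]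
  · simp [cB_rot, cA_I, cB_I]

lemma cosh_dist_I (z : UpperHalfPlane) : Real.cosh (dist z UpperHalfPlane.I) = cX z := by
  rw [cosh_dist_coord, cA_I, cB_I, cX_I]; ring

/-- Vertical axis. -/
noncomputable def axis (t : ℝ) : UpperHalfPlane :=
  UpperHalfPlane.mk ⟨0, Real.exp t⟩ (Real.exp_pos t)

lemma axis_re (t : ℝ) : (axis t).re = 0 := rfl
lemma axis_im (t : ℝ) : (axis t).im = Real.exp t := rfl

lemma axis_continuous : Continuous axis := (UpperHalfPlane.isometry_vertical_line 0).continuous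

lemma cA_axis (t : ℝ) : cA (axis t) = Real.sinh t := by
  unfold cA
  rw [axis_re, axis_im, Real.sinh_eq, Real.exp_neg]
  have := (Real.exp_pos t).ne'
  field_simp
  ring

lemma cX_axis (t : ℝ) : cX (axis t) = Real.cosh t := by
  unfold cX
  rw [axis_re, axis_im, Real.cosh_eq, Real.exp_neg]
  have := (Real.exp_pos t).ne'
  field_simp
  ring

lemma cB_axis (t : ℝ) : cB (axis t) = 0 := by simp [cB, axis_re]

lemma axis_zero : axis 0 = UpperHalfPlane.I := by
  apply coord_ext <;> simp [cA_axis, cB_axis, cA_I, cB_I]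

lemma dist_axis_I (t : ℝ) (ht : 0 ≤ t) : dist (axis t) UpperHalfPlane.I = t := by
  apply Real.cosh_strictMonoOn.injOn (x₁ := dist _ _) dist_nonneg ht
  rw [cosh_dist_I, cX_axis]

lemma ray_dir (g : ℝ → UpperHalfPlane) (h0 : g 0 = UpperHalfPlane.I)
    (hg : ∀ s t : ℝ, 0 ≤ s → 0 ≤ t → dist (g s) (g t) = |s - t|) :
    ∃ φ : ℝ, -Real.pi < φ ∧ φ ≤ Real.pi ∧ ∀ t : ℝ, 0 ≤ t → g t = rot φ (axis t) := by
  have hX : ∀ t, 0 ≤ t → cX (g t) = Real.cosh t := by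
    intro t ht
    rw [← cosh_dist_I, ← h0, hg t 0 ht le_rfl, sub_zero, abs_of_nonneg ht]
  have hAB : ∀ t, 0 ≤ t → cA (g t) ^ 2 + cB (g t) ^ 2 = Real.sinh t ^ 2 := by
    intro t ht
    have h1 := cX_sq (g t)
    rw [hX t ht, Real.cosh_sq] at h1
    linarith
  have hs1 : 0 < Real.sinh 1 := by
    rw [Real.sinh_pos_iff]; norm_num
  set w : ℂ := ⟨cA (g 1), cB (g 1)⟩ with hw
  have hwn : ‖w‖ = Real.sinh 1 := by
    rw [Complex.norm_eq_sqrt_sq_add_sq, hAB 1 zero_le_one, Real.sqrt_sq hs1.le]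
  have hw0 : w ≠ 0 := by
    intro h; rw [h, norm_zero] at hwn; exact hs1.ne hwn
  refine ⟨w.arg, Complex.neg_pi_lt_arg w, Complex.arg_le_pi w, fun t ht => ?_⟩
  have hc : Real.cos w.arg * Real.sinh 1 = cA (g 1) := by
    rw [Complex.cos_arg hw0, hwn, div_mul_cancel₀ _ hs1.ne']
  have hsn : Real.sin w.arg * Real.sinh 1 = cB (g 1) := by
    rw [Complex.sin_arg, hwn, div_mul_cancel₀ _ hs1.ne']
  have hd := cosh_dist_coord (g t) (g 1)
  rw [hg t 1 ht zero_le_one, Real.cosh_abs, hX t ht, hX 1 zero_le_one, Real.cosh_sub, ← hc, ← hsn]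
    at hd
  have hk : cA (g t) * Real.cos w.arg + cB (g t) * Real.sin w.arg = Real.sinh t := by
    apply mul_right_cancel₀ hs1.ne'
    linarith
  have h2 := hAB t ht
  have hsc := Real.sin_sq_add_cos_sq w.arg
  have hz : (cA (g t) - Real.sinh t * Real.cos w.arg) ^ 2
      + (cB (g t) - Real.sinh t * Real.sin w.arg) ^ 2 = 0 := by
    linear_combination h2 - 2 * Real.sinh t * hk + Real.sinh t ^ 2 * hsc
  have e1 : cA (g t) - Real.sinh t * Real.cos w.arg = 0 := by
    nlinarith [sq_nonneg (cA (g t) - Real.sinh t * Real.cos w.arg),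
      sq_nonneg (cB (g t) - Real.sinh t * Real.sin w.arg)]
  have e2 : cB (g t) - Real.sinh t * Real.sin w.arg = 0 := by
    nlinarith [sq_nonneg (cA (g t) - Real.sinh t * Real.cos w.arg),
      sq_nonneg (cB (g t) - Real.sinh t * Real.sin w.arg)]
  apply coord_ext
  · rw [cA_rot, cA_axis, cB_axis]; linarith
  · rw [cB_rot, cA_axis, cB_axis]; linarith

/-- Scaling by `e^k`. -/
noncomputable def sc (k : ℝ) : UpperHalfPlane ≃ᵢ UpperHalfPlane where
  toFun z := (⟨Real.exp k, Real.exp_pos k⟩ : {x : ℝ // 0 < x}) • z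
  invFun z := (⟨Real.exp (-k), Real.exp_pos (-k)⟩ : {x : ℝ // 0 < x}) • z
  left_inv z := by
    apply UpperHalfPlane.ext_re_im
    · simp only [UpperHalfPlane.pos_real_re, ← mul_assoc, ← Real.exp_add]; simp
    · simp only [UpperHalfPlane.pos_real_im, ← mul_assoc, ← Real.exp_add]; simp
  right_inv z := by
    apply UpperHalfPlane.ext_re_im
    · simp only [UpperHalfPlane.pos_real_re, ← mul_assoc, ← Real.exp_add]; simp
    · simp only [UpperHalfPlane.pos_real_im, ← mul_assoc, ← Real.exp_add]; simp
  isometry_toFun := UpperHalfPlane.isometry_pos_mul _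

lemma sc_re (k : ℝ) (z) : (sc k z).re = Real.exp k * z.re := UpperHalfPlane.pos_real_re _ _
lemma sc_im (k : ℝ) (z) : (sc k z).im = Real.exp k * z.im := UpperHalfPlane.pos_real_im _ _

lemma sc_axis (k t : ℝ) : sc k (axis t) = axis (k + t) := by
  apply UpperHalfPlane.ext_re_im
  · rw [sc_re, axis_re, axis_re, mul_zero]
  · rw [sc_im, axis_im, axis_im, Real.exp_add]

/-- Horizontal translation. -/
noncomputable def tr (a : ℝ) : UpperHalfPlane ≃ᵢ UpperHalfPlane where
  toFun z := a +ᵥ z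
  invFun z := (-a) +ᵥ z
  left_inv z := by simp
  right_inv z := by simp
  isometry_toFun := UpperHalfPlane.isometry_real_vadd a

lemma tr_re (k : ℝ) (z) : (tr k z).re = k + z.re := UpperHalfPlane.vadd_re _ _
lemma tr_im (k : ℝ) (z) : (tr k z).im = z.im := UpperHalfPlane.vadd_im _ _

lemma exists_iso (z : UpperHalfPlane) : ∃ φ : UpperHalfPlane ≃ᵢ UpperHalfPlane,
    φ UpperHalfPlane.I = z := by
  refine ⟨(sc (Real.log z.im)).trans (tr z.re), ?_⟩
  apply UpperHalfPlane.ext_re_im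
  · simp [tr_re, sc_re]
  · simp [tr_im, sc_im, Real.exp_log z.im_pos]

/-- Region, left side, right side of the thin tube of length `n`. -/
def tE (n : ℕ) : Set UpperHalfPlane := {z | 1 < z.im ∧ z.im < Real.exp n ∧ |z.re| < 4 * z.im}
def tL (δ : ℝ) (n : ℕ) : Set UpperHalfPlane := {z | z.re ≤ -(δ * Real.exp (-n) * z.im ^ 2)}
def tR (δ : ℝ) (n : ℕ) : Set UpperHalfPlane := {z | δ * Real.exp (-n) * z.im ^ 2 ≤ z.re}

/-- Same for the unit piece. -/
def bE : Set UpperHalfPlane :=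
  {z | Real.exp (-2) < z.im ∧ z.im < Real.exp 2 ∧ |z.re| < 4 * z.im}
def bL (w : ℝ) : Set UpperHalfPlane := {z | z.re ≤ -w}
def bR (w : ℝ) : Set UpperHalfPlane := {z | w ≤ z.re}

lemma tE_open (n : ℕ) : IsOpen (tE n) := by
  have h1 := UpperHalfPlane.continuous_im
  have h2 := UpperHalfPlane.continuous_re
  exact (isOpen_lt continuous_const h1).inter ((isOpen_lt h1 continuous_const).inter
    (isOpen_lt h2.abs (continuous_const.mul h1)))

lemma bE_open : IsOpen bE := by
  have h1 := UpperHalfPlane.continuous_im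
  have h2 := UpperHalfPlane.continuous_re
  exact (isOpen_lt continuous_const h1).inter ((isOpen_lt h1 continuous_const).inter
    (isOpen_lt h2.abs (continuous_const.mul h1)))

lemma tE_sub_ball (n : ℕ) : tE n ⊆ Metric.closedBall UpperHalfPlane.I (n + 3) := by
  rintro z ⟨h1, h2, h3⟩
  rw [Metric.mem_closedBall]
  have h0 : (0 : ℝ) ≤ n + 3 := by positivity
  rw [← Real.cosh_strictMonoOn.le_iff_le (a := dist _ _) dist_nonneg h0, cosh_dist_I]
  have hx : z.re ^ 2 ≤ 16 * z.im ^ 2 := by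
    rw [← sq_abs]; nlinarith [abs_nonneg z.re]
  have : cX z ≤ 9 * z.im := by
    unfold cX
    rw [div_le_iff₀ (by linarith)]
    nlinarith
  have he : Real.cosh (n + 3) ≥ Real.exp (n + 3) / 2 := by
    rw [Real.cosh_eq]; have := Real.exp_pos (-((n : ℝ) + 3)); linarith
  have h3 : Real.exp (3 : ℝ) ≥ 19 := by
    have h := Real.exp_one_gt_d9
    have : Real.exp (3 : ℝ) = Real.exp 1 ^ 3 := by rw [← Real.exp_nat_mul]; norm_num
    rw [this]
    nlinarith [pow_le_pow_left₀ (by norm_num : (0 : ℝ) ≤ 2.7) (by linarith : 2.7 ≤ Real.exp 1) 3]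
  rw [Real.exp_add] at he
  nlinarith [Real.exp_pos (n : ℝ)]

lemma cosh_one_le : Real.cosh 1 ≤ 1.6 := by
  rw [Real.cosh_eq, Real.exp_neg]
  have h := Real.exp_one_gt_d9
  have h2 := Real.exp_one_lt_d9
  have : (Real.exp 1)⁻¹ ≤ 0.4 := by
    rw [inv_le_comm₀ (by linarith) (by norm_num)]; norm_num; linarith
  linarith

lemma cosh_one_ge : 1.5 ≤ Real.cosh 1 := by
  rw [Real.cosh_eq, Real.exp_neg]
  have h := Real.exp_one_gt_d9
  have h2 := Real.exp_one_lt_d9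
  have : 0.36 ≤ (Real.exp 1)⁻¹ := by
    rw [le_inv_comm₀ (by norm_num) (by linarith)]; norm_num; linarith
  linarith

lemma ball_sub (a : ℝ) (ha : 0 ≤ a) (ha' : a ≤ 1 / 2) :
    Metric.closedBall UpperHalfPlane.I 1 ⊆ tr a '' bE := by
  intro z hz
  rw [Metric.mem_closedBall,
    ← Real.cosh_strictMonoOn.le_iff_le (a := dist _ _) dist_nonneg (mem_Ici.2 zero_le_one), cosh_dist_I] at hz
  have hz2 : cX z ≤ 1.6 := hz.trans cosh_one_le
  have hy := z.im_pos
  unfold cX at hz2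
  rw [div_le_iff₀ (by linarith)] at hz2
  refine ⟨(tr a).symm z, ?_, (tr a).apply_symm_apply z⟩
  have hre : ((tr a).symm z).re = z.re - a := by
    have := tr_re a ((tr a).symm z)
    rw [(tr a).apply_symm_apply] at this
    linarith
  have him : ((tr a).symm z).im = z.im := by
    have := tr_im a ((tr a).symm z)
    rw [(tr a).apply_symm_apply] at this
    linarith
  have he2 : 4 ≤ Real.exp 2 := by
    have h := Real.exp_one_gt_d9
    have : Real.exp (2 : ℝ) = Real.exp 1 ^ 2 := by rw [← Real.exp_nat_mul]; norm_num
    rw [this]; nlinarith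
  have hy1 : 0.3 ≤ z.im := by nlinarith [sq_nonneg z.re, sq_nonneg z.im]
  have hx1 : z.re ^ 2 ≤ (1.25 * z.im) ^ 2 := by nlinarith [sq_nonneg (1.6 * z.im - 1)]
  have hx2 := abs_le.1 (abs_le_of_sq_le_sq hx1 (by positivity))
  refine ⟨?_, ?_, ?_⟩
  · rw [him, Real.exp_neg]
    have : (Real.exp 2)⁻¹ ≤ 0.25 := by
      rw [inv_le_comm₀ (by linarith) (by norm_num)]; norm_num; linarith
    linarith
  · rw [him]; nlinarith [sq_nonneg z.re]
  · rw [him, hre, abs_lt]; constructor <;> linarith [hx2.1, hx2.2]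

lemma tr_axis_mem_ball (a t : ℝ) (ha : 0 ≤ a) (ha' : a ≤ 1 / 2) (ht : t ∈ Icc (-(1/2) : ℝ) (1/2)) :
    tr a (axis t) ∈ Metric.closedBall UpperHalfPlane.I 1 := by
  rw [Metric.mem_closedBall,
    ← Real.cosh_strictMonoOn.le_iff_le (a := dist _ _) dist_nonneg (mem_Ici.2 zero_le_one), cosh_dist_I]
  refine le_trans ?_ cosh_one_ge
  have h1 : cX (tr a (axis t)) = Real.cosh t + a ^ 2 / 2 * Real.exp (-t) := by
    unfold cX
    rw [tr_re, tr_im, axis_re, axis_im, Real.cosh_eq, Real.exp_neg]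
    have := (Real.exp_pos t).ne'
    field_simp
    ring
  have h2 : Real.cosh t ≤ 1.15 := by
    refine (Real.cosh_le_exp_half_sq t).trans ?_
    have : t ^ 2 / 2 ≤ 1 / 8 := by nlinarith [ht.1, ht.2]
    refine (Real.exp_le_exp.2 this).trans ?_
    have := Real.abs_exp_sub_one_sub_id_le (x := 1/8) (by norm_num [abs_le])
    rw [abs_le] at this
    norm_num at this ⊢
    linarith [this.2]
  have h3 : Real.exp (-t) ≤ 1.75 := by
    refine (Real.exp_le_exp.2 (by linarith [ht.1] : -t ≤ 1/2)).trans ?_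
    have := Real.abs_exp_sub_one_sub_id_le (x := 1/2) (by norm_num [abs_le])
    rw [abs_le] at this
    norm_num at this ⊢
    linarith [this.2]
  rw [h1]
  have := Real.exp_pos (-t)
  nlinarith [sq_nonneg a, mul_nonneg ha (by linarith : 0 ≤ 1/2 - a)]

/-- A closed set containing a ray of direction close to vertical has a crossing. -/
lemma sep (δ : ℝ) (hδ : 0 < δ) (hδ' : δ ≤ 1 / 2) (n : ℕ) (φ : ℝ)
    (hφ : |φ| ≤ δ * Real.exp (-n) / 2)
    (s : Set UpperHalfPlane) (hs : ∀ t : ℝ, 0 ≤ t → rot φ (axis t) ∈ s)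
    (C : Set UpperHalfPlane) (hC : IsPreconnected C) (hCE : C ⊆ tE n)
    (hL : (C ∩ tL δ n).Nonempty) (hR : (C ∩ tR δ n).Nonempty) (hd : Disjoint s C) : False := by
  set u := Real.cos φ with hu
  set v := Real.sin φ with hv
  have hen : Real.exp (-(n : ℝ)) ≤ 1 := by rw [Real.exp_le_one_iff]; simp
  have hen0 := Real.exp_pos (-(n : ℝ))
  have hφ1 : |φ| ≤ 1 / 4 := by nlinarith
  have hu1 : 7 / 8 ≤ u := by
    have := Real.one_sub_sq_div_two_le_cos (x := φ)
    have h2 : φ ^ 2 ≤ (1/4) ^ 2 := by rw [← sq_abs]; gcongr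
    linarith
  have hv1 : |v| ≤ δ * Real.exp (-n) / 2 := (Real.abs_sin_le_abs (x := φ)).trans hφ
  let q : UpperHalfPlane → ℝ := fun z => u * z.re - v * (z.re ^ 2 + z.im ^ 2 - 1) / 2
  have hq : Continuous q := by
    have h1 := UpperHalfPlane.continuous_im
    have h2 := UpperHalfPlane.continuous_re
    fun_prop
  have key : ∀ z ∈ tE n, δ * Real.exp (-n) * z.im ^ 2 ≤ |z.re| →
      |v * (z.re ^ 2 + z.im ^ 2 - 1) / 2| < u * |z.re| := by
    rintro z ⟨h1, h2, h3⟩ h4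
    have hre : 0 < |z.re| := lt_of_lt_of_le (by positivity) h4
    have hnn : 0 ≤ z.re ^ 2 + z.im ^ 2 - 1 := by nlinarith [sq_nonneg z.re]
    rw [abs_div, abs_mul, abs_of_nonneg hnn, abs_two]
    have hre2 : z.re ^ 2 ≤ 4 * z.im * |z.re| := by
      rw [← sq_abs]; nlinarith
    have hvy : |v| * z.im ≤ δ / 2 := by
      have : Real.exp (-n) * z.im ≤ 1 := by
        have h5 : Real.exp (-n) * z.im ≤ Real.exp (-(n:ℝ)) * Real.exp n := by gcongr
        rwa [← Real.exp_add, neg_add_cancel, Real.exp_zero] at h5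
      calc |v| * z.im ≤ (δ * Real.exp (-n) / 2) * z.im := by gcongr
        _ = δ / 2 * (Real.exp (-n) * z.im) := by ring
        _ ≤ δ / 2 * 1 := by gcongr
        _ = δ / 2 := by ring
    have hvy2 : |v| * z.im ^ 2 ≤ |z.re| / 2 := by
      calc |v| * z.im ^ 2 ≤ (δ * Real.exp (-n) / 2) * z.im ^ 2 := by gcongr
        _ ≤ |z.re| / 2 := by linarith
    have hvr : |v| * z.re ^ 2 ≤ 2 * δ * |z.re| := by
      calc |v| * z.re ^ 2 ≤ |v| * (4 * z.im * |z.re|) := by gcongr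
        _ = (|v| * z.im) * (4 * |z.re|) := by ring
        _ ≤ δ / 2 * (4 * |z.re|) := by gcongr
        _ = 2 * δ * |z.re| := by ring
    have : |v| * (z.re ^ 2 + z.im ^ 2 - 1) ≤ 2 * δ * |z.re| + |z.re| / 2 := by
      have := abs_nonneg v
      nlinarith
    nlinarith
  obtain ⟨a, haC, haL⟩ := hL
  obtain ⟨b, hbC, hbR⟩ := hR
  have ha0 : a.re ≤ 0 := le_trans haL (by
    have : 0 ≤ δ * Real.exp (-n) * a.im ^ 2 := by positivity
    linarith)
  have hb0 : 0 ≤ b.re := le_trans (by positivity) hbR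
  have hqa : q a ≤ 0 := by
    have h := key a (hCE haC) (by rw [abs_of_nonpos ha0]; have : a.re ≤ _ := haL; linarith)
    rw [abs_of_nonpos ha0] at h
    have := (abs_lt.1 h).1
    simp only [q]; linarith
  have hqb : 0 ≤ q b := by
    have h := key b (hCE hbC) (by rw [abs_of_nonneg hb0]; exact hbR)
    rw [abs_of_nonneg hb0] at h
    have := (abs_lt.1 h).2
    simp only [q]; linarith
  obtain ⟨z, hzC, hz0⟩ := hC.intermediate_value haC hbC hq.continuousOn ⟨hqa, hqb⟩
  have hzE := hCE hzC
  have hy := z.im_pos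
  have hAB : u * cB z = v * cA z := by
    simp only [q] at hz0
    unfold cA cB
    field_simp
    linarith
  have hsc := Real.sin_sq_add_cos_sq φ
  rw [← hu, ← hv] at hsc
  have hA0 : 0 ≤ cA z := by
    unfold cA
    apply div_nonneg _ (by linarith)
    nlinarith [sq_nonneg z.re, hzE.1]
  have hA : cA z = u * (u * cA z + v * cB z) := by linear_combination (-cA z) * hsc + (-v) * hAB
  have hB : cB z = v * (u * cA z + v * cB z) := by linear_combination (-cB z) * hsc + u * hAB
  have hτ : 0 ≤ u * cA z + v * cB z := by
    by_contra hneg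
    push Not at hneg
    nlinarith
  have hzray : z = rot φ (axis (Real.arsinh (u * cA z + v * cB z))) := by
    apply coord_ext
    · rw [cA_rot, cA_axis, cB_axis, Real.sinh_arsinh, mul_zero, sub_zero]; exact hA
    · rw [cB_rot, cA_axis, cB_axis, Real.sinh_arsinh, mul_zero, add_zero]; exact hB
  have hmem := hs _ (Real.arsinh_nonneg_iff.2 hτ)
  rw [← hzray] at hmem
  exact hd.le_bot ⟨hmem, hzC⟩

lemma kill_near (n : ℕ) (δ b φ : ℝ) (hδ : 0 < δ) (hδ' : δ ≤ 1 / 2) (hb : 0 ≤ b)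
    (hφ : |φ| ≤ δ * Real.exp (-n) / 2) :
    dist (rot φ (axis (n + b))) (axis (n + b)) ≤ 2 * b + 2 := by
  rw [← Real.cosh_strictMonoOn.le_iff_le (a := dist _ _) dist_nonneg
    (by simp only [mem_Ici]; linarith)]
  have hXr : cX (rot φ (axis (n + b))) = cX (axis (n + b)) := by
    rw [← cosh_dist_I, ← cosh_dist_I]
    conv_lhs => rw [← rot_I φ]
    rw [(rot φ).dist_eq]
  rw [cosh_dist_coord, hXr, cA_rot, cB_rot, cX_axis, cA_axis, cB_axis]
  set T := (n : ℝ) + b with hT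
  have h1 := Real.cosh_sq T
  have hu := Real.one_sub_sq_div_two_le_cos (x := φ)
  have hφ2 : φ ^ 2 ≤ (δ * Real.exp (-n) / 2) ^ 2 := by rw [← sq_abs]; gcongr
  have hT0 : 0 ≤ T := by positivity
  have hs : Real.sinh T ^ 2 ≤ Real.exp T ^ 2 := by
    have : Real.sinh T ≤ Real.exp T := by
      rw [Real.sinh_eq]; linarith [Real.exp_pos T, Real.exp_pos (-T)]
    have h0 := Real.sinh_nonneg_iff.2 hT0
    gcongr
  have he : Real.exp (-n) ^ 2 * Real.exp T ^ 2 = Real.exp (2 * b) := by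
    rw [← mul_pow, ← Real.exp_add, hT, ← Real.exp_nat_mul]; congr 1; push_cast; ring
  have hprod : φ ^ 2 * Real.sinh T ^ 2 ≤ Real.exp (2 * b) := by
    calc φ ^ 2 * Real.sinh T ^ 2 ≤ (δ * Real.exp (-n) / 2) ^ 2 * Real.exp T ^ 2 := by gcongr
      _ = (δ / 2) ^ 2 * (Real.exp (-n) ^ 2 * Real.exp T ^ 2) := by ring
      _ = (δ / 2) ^ 2 * Real.exp (2 * b) := by rw [he]
      _ ≤ 1 * Real.exp (2 * b) := by
          gcongr
          nlinarith
      _ = _ := one_mul _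
  have hge : 1 + Real.exp (2 * b) ≤ Real.cosh (2 * b + 2) := by
    have he2 : 4 ≤ Real.exp 2 := by
      have h := Real.exp_one_gt_d9
      have : Real.exp (2 : ℝ) = Real.exp 1 ^ 2 := by rw [← Real.exp_nat_mul]; norm_num
      rw [this]; nlinarith
    have h1 : 1 ≤ Real.exp (2 * b) := by rw [Real.one_le_exp_iff]; linarith
    rw [Real.cosh_eq, Real.exp_add]
    nlinarith [Real.exp_pos (-(2 * b + 2))]
  refine le_trans ?_ hge
  have : (1 - Real.cos φ) * Real.sinh T ^ 2 ≤ φ ^ 2 / 2 * Real.sinh T ^ 2 := by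
    gcongr; linarith
  nlinarith [sq_nonneg (φ * Real.sinh T)]

end Vis

namespace Vis

/-- σ-algebra of avoidance events for compact subsets of `A`. -/
def avoidS (A : Set UpperHalfPlane) : MeasurableSpace (Set UpperHalfPlane) :=
  MeasurableSpace.generateFrom {T | ∃ K, IsCompact K ∧ K ⊆ A ∧ T = {s | Disjoint s K}}

/-- A property of closed sets that depends measurably on the trace on `A`. -/
def Ev (A : Set UpperHalfPlane) (T : Set (Set UpperHalfPlane)) : Prop :=
  ∃ T', MeasurableSet[avoidS A] T' ∧ ∀ s, IsClosed s → (s ∈ T ↔ s ∈ T')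

lemma Ev.mono {A A' T} (h : A ⊆ A') (hT : Ev A T) : Ev A' T := by
  obtain ⟨T', h1, h2⟩ := hT
  refine ⟨T', ?_, h2⟩
  have : avoidS A ≤ avoidS A' := by
    apply MeasurableSpace.generateFrom_mono
    rintro _ ⟨K, hK, hKA, rfl⟩
    exact ⟨K, hK, hKA.trans h, rfl⟩
  exact this _ h1

lemma Ev.congr {A T T'} (hT : Ev A T) (h : ∀ s, IsClosed s → (s ∈ T' ↔ s ∈ T)) : Ev A T' := by
  obtain ⟨T1, h1, h2⟩ := hT
  exact ⟨T1, h1, fun s hs => (h s hs).trans (h2 s hs)⟩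

lemma Ev.compl {A T} (hT : Ev A T) : Ev A Tᶜ := by
  obtain ⟨T1, h1, h2⟩ := hT
  exact ⟨T1ᶜ, h1.compl, fun s hs => not_congr (h2 s hs)⟩

lemma Ev.inter {A T T'} (hT : Ev A T) (hT' : Ev A T') : Ev A (T ∩ T') := by
  obtain ⟨T1, h1, h2⟩ := hT
  obtain ⟨T2, h3, h4⟩ := hT'
  exact ⟨T1 ∩ T2, h1.inter h3, fun s hs => and_congr (h2 s hs) (h4 s hs)⟩

lemma Ev.iUnion {A} {ι : Type*} [Countable ι] {T : ι → Set (Set UpperHalfPlane)}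
    (hT : ∀ i, Ev A (T i)) : Ev A (⋃ i, T i) := by
  choose T' h1 h2 using hT
  refine ⟨⋃ i, T' i, MeasurableSet.iUnion h1, fun s hs => ?_⟩
  simp only [mem_iUnion]
  exact exists_congr fun i => h2 i s hs

lemma Ev.iInter {A} {ι : Type*} [Countable ι] {T : ι → Set (Set UpperHalfPlane)}
    (hT : ∀ i, Ev A (T i)) : Ev A (⋂ i, T i) := by
  choose T' h1 h2 using hT
  refine ⟨⋂ i, T' i, MeasurableSet.iInter h1, fun s hs => ?_⟩
  simp only [mem_iInter]
  exact forall_congr' fun i => h2 i s hs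

lemma Ev.univ {A} : Ev A Set.univ := ⟨Set.univ, MeasurableSet.univ, fun _ _ => Iff.rfl⟩

lemma Ev.disj {A K : Set UpperHalfPlane} (hK : IsCompact K) (h : K ⊆ A) :
    Ev A {s | Disjoint s K} :=
  ⟨_, MeasurableSpace.measurableSet_generateFrom ⟨K, hK, h, rfl⟩, fun _ _ => Iff.rfl⟩

lemma disjoint_preimage_iff (φ : UpperHalfPlane ≃ᵢ UpperHalfPlane) (s K : Set UpperHalfPlane) :
    Disjoint (φ ⁻¹' s) K ↔ Disjoint s (φ '' K) := by
  rw [Set.disjoint_left, Set.disjoint_right]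
  constructor
  · rintro h _ ⟨a, ha, rfl⟩ hs
    exact h hs ha
  · intro h a ha hK
    exact h ⟨a, hK, rfl⟩ ha

lemma measurable_preimage (φ : UpperHalfPlane ≃ᵢ UpperHalfPlane) (A : Set UpperHalfPlane) :
    @Measurable _ _ (avoidS (φ '' A)) (avoidS A) (fun s => φ ⁻¹' s) := by
  refine @measurable_generateFrom _ _ (avoidS (φ '' A)) _ _ ?_
  rintro _ ⟨K, hK, hKA, rfl⟩
  refine MeasurableSpace.measurableSet_generateFrom ⟨φ '' K, hK.image φ.continuous,
    image_mono hKA, ?_⟩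
  ext s
  exact disjoint_preimage_iff φ s K

lemma Ev.map {A T} (φ : UpperHalfPlane ≃ᵢ UpperHalfPlane) (hT : Ev A T) :
    Ev (φ '' A) {s | φ ⁻¹' s ∈ T} := by
  obtain ⟨T1, h1, h2⟩ := hT
  refine ⟨(fun s => φ ⁻¹' s) ⁻¹' T1, measurable_preimage φ A h1, fun s hs => ?_⟩
  exact h2 _ (hs.preimage φ.continuous)

lemma Ev.subset {S A : Set UpperHalfPlane} (h : S ⊆ A) : Ev A {s | S ⊆ s} := by
  obtain ⟨c, hcS, hc, hSc⟩ :=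
    (TopologicalSpace.IsSeparable.of_separableSpace S).exists_countable_dense_subset
  have : Countable c := hc
  have h1 : Ev A (⋂ x : c, {s | Disjoint s {x.1}}ᶜ) :=
    Ev.iInter fun x => (Ev.disj isCompact_singleton (by
      simpa using h (hcS x.2))).compl
  refine h1.congr fun s hs => ?_
  simp only [mem_iInter, mem_compl_iff, mem_setOf_eq, disjoint_singleton_right, not_not,
    Subtype.forall]
  exact ⟨fun H x hx => H (hcS hx), fun H => hSc.trans (closure_minimal H hs)⟩

/-- There is a compact connected set in `E`, avoiding `s`, joining `L` to `R`. -/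
def Blk (E L R s : Set UpperHalfPlane) : Prop :=
  ∃ C, IsCompact C ∧ IsPreconnected C ∧ C ⊆ E ∧ (C ∩ L).Nonempty ∧ (C ∩ R).Nonempty ∧ Disjoint s C

lemma Blk.map {E L R s E' L' R' : Set UpperHalfPlane} (φ : UpperHalfPlane ≃ᵢ UpperHalfPlane)
    (h : Blk E L R (φ ⁻¹' s)) (hE : ∀ z ∈ E, φ z ∈ E') (hL : ∀ z ∈ E, z ∈ L → φ z ∈ L')
    (hR : ∀ z ∈ E, z ∈ R → φ z ∈ R') : Blk E' L' R' s := by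
  obtain ⟨C, h1, h2, h3, ⟨a, haC, haL⟩, ⟨b, hbC, hbR⟩, h6⟩ := h
  refine ⟨φ '' C, h1.image φ.continuous, h2.image _ φ.continuous.continuousOn, ?_,
    ⟨φ a, ⟨a, haC, rfl⟩, hL a (h3 haC) haL⟩, ⟨φ b, ⟨b, hbC, rfl⟩, hR b (h3 hbC) hbR⟩,
    (disjoint_preimage_iff φ s C).1 h6⟩
  rintro _ ⟨z, hz, rfl⟩
  exact hE z (h3 hz)

lemma closedBall_preconnected (z : UpperHalfPlane) (r : ℝ) :
    IsPreconnected (Metric.closedBall z r) := by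
  rw [← UpperHalfPlane.isEmbedding_coe.isInducing.isPreconnected_image,
    UpperHalfPlane.image_coe_closedBall]
  exact (convex_closedBall _ _).isPreconnected

/-- Finite unions of balls from a countable family. -/
noncomputable def fUn (F : Finset (ℕ × ℕ)) : Set UpperHalfPlane :=
  ⋃ a ∈ F, Metric.closedBall (TopologicalSpace.denseSeq UpperHalfPlane a.1) (1 / ((a.2 : ℝ) + 1))

lemma fUn_compact (F : Finset (ℕ × ℕ)) : IsCompact (fUn F) :=
  F.isCompact_biUnion fun _ _ => isCompact_closedBall _ _

lemma exists_fUn {U C : Set UpperHalfPlane} (hU : IsOpen U) (hC : IsCompact C)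
    (hCc : IsPreconnected C) (hCU : C ⊆ U) (hne : C.Nonempty) :
    ∃ F, C ⊆ fUn F ∧ fUn F ⊆ U ∧ IsPreconnected (fUn F) := by
  classical
  have hpt : ∀ x ∈ C, ∃ a : ℕ × ℕ,
      x ∈ Metric.ball (TopologicalSpace.denseSeq UpperHalfPlane a.1) (1 / ((a.2 : ℝ) + 1)) ∧
      Metric.closedBall (TopologicalSpace.denseSeq UpperHalfPlane a.1) (1 / ((a.2 : ℝ) + 1)) ⊆ U := by
    intro x hx
    obtain ⟨ε, hε, hεU⟩ := Metric.isOpen_iff.1 hU x (hCU hx)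
    obtain ⟨k, hk⟩ := exists_nat_one_div_lt (half_pos hε)
    have hk0 : (0 : ℝ) < 1 / ((k : ℝ) + 1) := by positivity
    obtain ⟨y, hy, i, rfl⟩ := (TopologicalSpace.denseRange_denseSeq UpperHalfPlane).exists_mem_open
      (Metric.isOpen_ball (x := x) (ε := 1 / ((k : ℝ) + 1))) ⟨x, Metric.mem_ball_self hk0⟩ |>.elim
        fun i hi => (⟨_, hi, i, rfl⟩ : ∃ y ∈ Metric.ball x (1 / ((k : ℝ) + 1)),
          ∃ i, TopologicalSpace.denseSeq UpperHalfPlane i = y)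
    refine ⟨(i, k), ?_, ?_⟩
    · rw [Metric.mem_ball, dist_comm]; exact hy
    · intro z hz
      apply hεU
      rw [Metric.mem_ball] at hy ⊢
      rw [Metric.mem_closedBall] at hz
      have := dist_triangle z (TopologicalSpace.denseSeq UpperHalfPlane i) x
      simp only at hz
      linarith
  choose! a ha1 ha2 using hpt
  obtain ⟨t, htC, htcov⟩ := hC.elim_nhds_subcover
    (fun x => Metric.ball (TopologicalSpace.denseSeq UpperHalfPlane (a x).1) (1 / (((a x).2 : ℝ) + 1)))
    (fun x hx => Metric.isOpen_ball.mem_nhds (ha1 x hx))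
  have hcov : C ⊆ fUn (t.image a) := by
    intro x hx
    obtain ⟨y, hy, hxy⟩ := mem_iUnion₂.1 (htcov hx)
    exact mem_iUnion₂.2 ⟨a y, Finset.mem_image_of_mem a hy, Metric.ball_subset_closedBall hxy⟩
  refine ⟨t.image a, hcov, ?_, ?_⟩
  · intro x hx
    obtain ⟨b, hb, hxb⟩ := mem_iUnion₂.1 hx
    obtain ⟨y, hy, rfl⟩ := Finset.mem_image.1 hb
    exact ha2 y (htC y hy) hxb
  · obtain ⟨x0, hx0⟩ := hne
    refine isPreconnected_of_forall x0 fun z hz => ?_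
    obtain ⟨b, hb, hzb⟩ := mem_iUnion₂.1 hz
    obtain ⟨y, hy, rfl⟩ := Finset.mem_image.1 hb
    refine ⟨C ∪ Metric.closedBall (TopologicalSpace.denseSeq UpperHalfPlane (a y).1)
      (1 / (((a y).2 : ℝ) + 1)), ?_, Or.inl hx0, Or.inr hzb, ?_⟩
    · exact union_subset hcov (fun w hw => mem_iUnion₂.2 ⟨a y, hb, hw⟩)
    · exact hCc.union y (htC y hy) (Metric.ball_subset_closedBall (ha1 y (htC y hy)))
        (closedBall_preconnected _ _)

lemma Ev.blk {E L R : Set UpperHalfPlane} (hE : IsOpen E) : Ev E {s | Blk E L R s} := by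
  let ι := {F : Finset (ℕ × ℕ) // IsPreconnected (fUn F) ∧ fUn F ⊆ E ∧ (fUn F ∩ L).Nonempty ∧
    (fUn F ∩ R).Nonempty}
  have h1 : Ev E (⋃ F : ι, {s | Disjoint s (fUn F.1)}) :=
    Ev.iUnion fun F => Ev.disj (fUn_compact _) F.2.2.1
  refine h1.congr fun s hs => ?_
  simp only [mem_iUnion, mem_setOf_eq]
  constructor
  · rintro ⟨C, h1, h2, h3, h4, h5, h6⟩
    obtain ⟨F, hF1, hF2, hF3⟩ := exists_fUn (hE.sdiff hs) h1 h2
      (fun x hx => ⟨h3 hx, fun hxs => h6.le_bot ⟨hxs, hx⟩⟩) (h4.mono inter_subset_left)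
    refine ⟨⟨F, hF3, hF2.trans diff_subset, h4.mono (inter_subset_inter_left _ hF1),
      h5.mono (inter_subset_inter_left _ hF1)⟩, ?_⟩
    exact Set.disjoint_right.2 fun x hx => (hF2 hx).2
  · rintro ⟨⟨F, hF1, hF2, hF3, hF4⟩, hd⟩
    exact ⟨fUn F, fUn_compact F, hF1, hF2, hF3, hF4, hd⟩

lemma path_lemma {U V : Set UpperHalfPlane} (hU : IsOpen U) (hV : IsPreconnected V) (hVU : V ⊆ U)
    {a b : UpperHalfPlane} (ha : a ∈ V) (hb : b ∈ V) :
    ∃ C, IsCompact C ∧ IsPreconnected C ∧ C ⊆ U ∧ a ∈ C ∧ b ∈ C := by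
  have h1 : V ⊆ connectedComponentIn U a := hV.subset_connectedComponentIn ha hVU
  have ho : IsOpen (connectedComponentIn U a) := hU.connectedComponentIn
  have hc : IsConnected (connectedComponentIn U a) :=
    isConnected_connectedComponentIn_iff.2 (hVU ha)
  have hp := (ho.isConnected_iff_isPathConnected).1 hc
  obtain ⟨γ, hγ⟩ := hp.joinedIn a (h1 ha) b (h1 hb)
  refine ⟨range γ, isCompact_range γ.continuous, isPreconnected_range γ.continuous, ?_,
    ⟨0, γ.source⟩, ⟨1, γ.target⟩⟩
  rintro _ ⟨t, rfl⟩
  exact connectedComponentIn_subset _ _ (hγ t)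

/-- Crossing event for the tube of length `n`. -/
def tS (δ : ℝ) (n : ℕ) : Set (Set UpperHalfPlane) := {s | Blk (tE n) (tL δ n) (tR δ n) s}ᶜ

/-- Chord. -/
def chord : Set UpperHalfPlane := axis '' Icc (-(1/2)) (1/2)

/-- Bad event for the unit piece. -/
def bD (w : ℝ) : Set (Set UpperHalfPlane) :=
  {s | chord ⊆ s}ᶜ ∩ {s | Blk bE (bL w) (bR w) s}ᶜ

lemma chord_sub : chord ⊆ bE := by
  rintro _ ⟨t, ⟨h1, h2⟩, rfl⟩
  refine ⟨?_, ?_, ?_⟩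
  · rw [axis_im, Real.exp_lt_exp]; linarith
  · rw [axis_im, Real.exp_lt_exp]; linarith
  · rw [axis_re, axis_im, abs_zero]; have := Real.exp_pos t; linarith

lemma ev_tS (δ : ℝ) (n : ℕ) : Ev (tE n) (tS δ n) := (Ev.blk (tE_open n)).compl

lemma ev_bD (w : ℝ) : Ev bE (bD w) :=
  (Ev.subset chord_sub).compl.inter (Ev.blk bE_open).compl

lemma tE_zero : tE 0 = ∅ := by
  ext z
  simp only [tE, mem_setOf_eq, mem_empty_iff_false, iff_false]
  rintro ⟨h1, h2, -⟩
  simp at h2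
  linarith

lemma tS_zero (δ : ℝ) (s) : s ∈ tS δ 0 := by
  rintro ⟨C, -, -, h, ⟨a, ha, -⟩, -⟩
  rw [tE_zero] at h
  exact h ha

lemma tS_left {δ : ℝ} (hδ : 0 < δ) {n j : ℕ} (hj : j ≤ n) {s} (hs : s ∈ tS δ n) : s ∈ tS δ j := by
  intro h
  apply hs
  have hjn : (j : ℝ) ≤ n := by exact_mod_cast hj
  have h' : Blk (tE j) (tL δ j) (tR δ j) (IsometryEquiv.refl UpperHalfPlane ⁻¹' s) := h
  have key : ∀ z : UpperHalfPlane, δ * Real.exp (-n) * z.im ^ 2 ≤ δ * Real.exp (-j) * z.im ^ 2 := by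
    intro z
    gcongr
  refine h'.map (IsometryEquiv.refl UpperHalfPlane) ?_ ?_ ?_
  · rintro z ⟨h1, h2, h3⟩
    exact ⟨h1, h2.trans_le (Real.exp_le_exp.2 hjn), h3⟩
  · intro z _ hz
    have hz : z.re ≤ _ := hz
    show z.re ≤ -(δ * Real.exp (-n) * z.im ^ 2)
    linarith [key z]
  · intro z _ hz
    have hz : _ ≤ z.re := hz
    show δ * Real.exp (-n) * z.im ^ 2 ≤ z.re
    linarith [key z]

lemma tS_right {δ : ℝ} {n k : ℕ} {s} (hs : s ∈ tS δ n) :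
    sc k ⁻¹' s ∈ tS δ (n - k) := by
  rcases le_or_gt k n with hk | hk
  swap
  · rw [Nat.sub_eq_zero_of_le hk.le]; exact tS_zero _ _
  intro h
  apply hs
  have hc : ((n - k : ℕ) : ℝ) = n - k := by push_cast [hk]; ring
  have hek := Real.exp_pos (k : ℝ)
  have key : ∀ z : UpperHalfPlane, δ * Real.exp (-n) * (Real.exp k * z.im) ^ 2 =
      Real.exp k * (δ * Real.exp (-((n - k : ℕ) : ℝ)) * z.im ^ 2) := by
    intro z
    have : Real.exp (-((n - k : ℕ) : ℝ)) = Real.exp (-n) * Real.exp k := by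
      rw [← Real.exp_add, hc]; congr 1; ring
    rw [this]; ring
  refine h.map (sc k) ?_ ?_ ?_
  · rintro z ⟨h1, h2, h3⟩
    refine ⟨?_, ?_, ?_⟩
    · rw [sc_im]
      have : 1 ≤ Real.exp (k : ℝ) := by rw [Real.one_le_exp_iff]; positivity
      nlinarith
    · rw [sc_im]
      have : Real.exp (n : ℝ) = Real.exp k * Real.exp ((n - k : ℕ) : ℝ) := by
        rw [← Real.exp_add, hc]; congr 1; ring
      rw [this]
      gcongr
    · rw [sc_im, sc_re, abs_mul, abs_of_pos hek]; nlinarith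
  · intro z _ hz
    have hz : z.re ≤ _ := hz
    show (sc k z).re ≤ -(δ * Real.exp (-n) * (sc k z).im ^ 2)
    rw [sc_re, sc_im, key]
    nlinarith
  · intro z _ hz
    have hz : _ ≤ z.re := hz
    show δ * Real.exp (-n) * (sc k z).im ^ 2 ≤ (sc k z).re
    rw [sc_re, sc_im, key]
    nlinarith

lemma tS_mid {δ : ℝ} (hδ : 0 < δ) {n k : ℕ} (hk : 2 ≤ k) (hkn : k + 2 ≤ n) {s} (hs : s ∈ tS δ n)
    {t : ℝ} (ht : |t - k| ≤ 1 / 2) (hts : axis t ∉ s) :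
    sc k ⁻¹' s ∈ bD (δ * Real.exp 4 * Real.exp (k - n)) := by
  have hek := Real.exp_pos (k : ℝ)
  refine ⟨?_, ?_⟩
  · intro h
    apply hts
    have h1 : axis (t - k) ∈ sc k ⁻¹' s := h ⟨t - k, by rw [abs_le] at ht; exact ht, rfl⟩
    rw [mem_preimage, sc_axis] at h1
    simpa using h1
  · intro h
    apply hs
    have hk' : (2 : ℝ) ≤ k := by exact_mod_cast hk
    have hkn' : (k : ℝ) + 2 ≤ n := by exact_mod_cast hkn
    have key : ∀ z ∈ bE, δ * Real.exp (-n) * (Real.exp k * z.im) ^ 2 ≤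
        Real.exp k * (δ * Real.exp 4 * Real.exp (k - n)) := by
      rintro z ⟨h1, h2, h3⟩
      have h4 : z.im ^ 2 ≤ Real.exp 4 := by
        have : Real.exp (4 : ℝ) = Real.exp 2 ^ 2 := by rw [← Real.exp_nat_mul]; norm_num
        rw [this]
        have := z.im_pos
        gcongr
      have h5 : Real.exp ((k : ℝ) - n) = Real.exp k * Real.exp (-n) := by
        rw [← Real.exp_add]; congr 1
      rw [h5]
      calc δ * Real.exp (-n) * (Real.exp k * z.im) ^ 2
          = δ * Real.exp (-n) * Real.exp k ^ 2 * z.im ^ 2 := by ring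
        _ ≤ δ * Real.exp (-n) * Real.exp k ^ 2 * Real.exp 4 := by gcongr
        _ = _ := by ring
    refine h.map (sc k) ?_ ?_ ?_
    · rintro z ⟨h1, h2, h3⟩
      refine ⟨?_, ?_, ?_⟩
      · rw [sc_im]
        calc (1 : ℝ) ≤ Real.exp (k + -2) := by rw [Real.one_le_exp_iff]; linarith
          _ = Real.exp k * Real.exp (-2) := Real.exp_add _ _
          _ < _ := by gcongr
      · rw [sc_im]
        calc Real.exp k * z.im < Real.exp k * Real.exp 2 := by gcongr
          _ = Real.exp (k + 2) := (Real.exp_add _ _).symm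
          _ ≤ _ := Real.exp_le_exp.2 hkn'
      · rw [sc_im, sc_re, abs_mul, abs_of_pos hek]; nlinarith
    · intro z hzE hz
      have hz : z.re ≤ _ := hz
      show (sc k z).re ≤ -(δ * Real.exp (-n) * (sc k z).im ^ 2)
      rw [sc_re, sc_im]
      nlinarith [key z hzE]
    · intro z hzE hz
      have hz : _ ≤ z.re := hz
      show δ * Real.exp (-n) * (sc k z).im ^ 2 ≤ (sc k z).re
      rw [sc_re, sc_im]
      nlinarith [key z hzE]

/-- Number of separated vacant points in the unit ball is at most `N`. -/
def SepBound (s : Set UpperHalfPlane) (N : ℝ≥0∞) : Prop :=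
  ∀ J : Finset UpperHalfPlane, (∀ p ∈ J, p ∈ Metric.closedBall UpperHalfPlane.I 1 \ s) →
    (∀ p ∈ J, ∀ q ∈ J, p ≠ q → ¬ ∃ V, IsPreconnected V ∧
      V ⊆ Metric.closedBall UpperHalfPlane.I 1 \ s ∧ p ∈ V ∧ q ∈ V) → (J.card : ℝ≥0∞) ≤ N

lemma count (s : Set UpperHalfPlane) (hs : IsClosed s) (N : ℝ≥0∞) (hN : SepBound s N)
    (w : ℝ) (hw : 0 < w) (J : Finset ℕ) (hJ : ∀ j ∈ J, (j : ℝ) * w ≤ 1 / 2)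
    (hD : ∀ j ∈ J, tr (j * w) ⁻¹' s ∈ bD w) : (J.card : ℝ≥0∞) ≤ 2 * N := by
  classical
  have hp : ∀ j ∈ J, ∃ p, p ∈ Metric.closedBall UpperHalfPlane.I 1 \ s ∧ p.re = j * w := by
    intro j hj
    obtain ⟨h1, -⟩ := hD j hj
    simp only [mem_compl_iff, mem_setOf_eq, not_subset] at h1
    obtain ⟨_, ⟨t, ht, rfl⟩, hts⟩ := h1
    refine ⟨tr (j * w) (axis t), ⟨tr_axis_mem_ball _ _ (by positivity) (hJ j hj) ht, hts⟩, ?_⟩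
    rw [tr_re, axis_re, add_zero]
  choose! p hp1 hp2 using hp
  let neg : ℕ → Prop := fun j => ∃ V, IsPreconnected V ∧
      V ⊆ Metric.closedBall UpperHalfPlane.I 1 \ s ∧ p j ∈ V ∧ ∃ z ∈ V, z.re ≤ (j - 1) * w
  have hpos : ∀ j ∈ J, neg j → ¬ ∃ V, IsPreconnected V ∧
      V ⊆ Metric.closedBall UpperHalfPlane.I 1 \ s ∧ p j ∈ V ∧ ∃ z ∈ V, (j + 1) * w ≤ z.re := by
    rintro j hj ⟨V1, a1, a2, a3, x, hx, hxr⟩ ⟨V2, b1, b2, b3, y, hy, hyr⟩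
    have hV := a1.union (p j) a3 b3 b1
    have hopen : IsOpen ((tr (j * w) '' bE) \ s) :=
      ((tr (j * w)).toHomeomorph.isOpenMap _ bE_open).sdiff hs
    have hsub : V1 ∪ V2 ⊆ (tr (j * w) '' bE) \ s := by
      refine (union_subset a2 b2).trans ?_
      exact diff_subset_diff_left (ball_sub _ (by positivity) (hJ j hj))
    obtain ⟨C, c1, c2, c3, c4, c5⟩ := path_lemma hopen hV hsub (Or.inl hx) (Or.inr hy)
    apply (hD j hj).2
    have hsymm : (tr (j * w)).symm ⁻¹' (tr (j * w) ⁻¹' s) = s := by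
      ext z; simp
    have hB : Blk (tr (j * w) '' bE) {z | z.re ≤ (j - 1) * w} {z | (j + 1) * w ≤ z.re}
        ((tr (j * w)).symm ⁻¹' (tr (j * w) ⁻¹' s)) := by
      rw [hsymm]
      exact ⟨C, c1, c2, c3.trans diff_subset, ⟨x, c4, hxr⟩, ⟨y, c5, hyr⟩,
        Set.disjoint_right.2 fun z hz => (c3 hz).2⟩
    refine hB.map (tr (j * w)).symm ?_ ?_ ?_
    · rintro _ ⟨z, hz, rfl⟩; simpa using hz
    · rintro _ ⟨z, hz, rfl⟩ h
      simp only [IsometryEquiv.symm_apply_apply, mem_setOf_eq, tr_re] at h ⊢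
      show z.re ≤ -w
      linarith
    · rintro _ ⟨z, hz, rfl⟩ h
      simp only [IsometryEquiv.symm_apply_apply, mem_setOf_eq, tr_re] at h ⊢
      show w ≤ z.re
      linarith
  have hinj : ∀ J' ⊆ J, (J'.image p).card = J'.card := by
    intro J' hJ'
    apply Finset.card_image_of_injOn
    intro i hi j hj hij
    have h1 := hp2 i (hJ' hi)
    have h2 := hp2 j (hJ' hj)
    have hij : p i = p j := hij
    rw [hij, h2] at h1
    have := mul_right_cancel₀ hw.ne' h1
    exact_mod_cast this.symm
  have hc1 : ((J.filter neg).card : ℝ≥0∞) ≤ N := by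
    rw [← hinj _ (Finset.filter_subset _ _)]
    apply hN
    · intro q hq
      obtain ⟨j, hj, rfl⟩ := Finset.mem_image.1 hq
      exact hp1 j (Finset.mem_filter.1 hj).1
    · intro q hq q' hq' hne ⟨V, v1, v2, v3, v4⟩
      obtain ⟨j, hj, rfl⟩ := Finset.mem_image.1 hq
      obtain ⟨j', hj', rfl⟩ := Finset.mem_image.1 hq'
      obtain ⟨hj, hjn⟩ := Finset.mem_filter.1 hj
      obtain ⟨hj', hjn'⟩ := Finset.mem_filter.1 hj'
      rcases lt_trichotomy j j' with h | h | h
      · refine hpos j hj hjn ⟨V, v1, v2, v3, p j', v4, ?_⟩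
        rw [hp2 j' hj']
        have : (j : ℝ) + 1 ≤ j' := by exact_mod_cast h
        gcongr
      · exact hne (by rw [h])
      · refine hpos j' hj' hjn' ⟨V, v1, v2, v4, p j, v3, ?_⟩
        rw [hp2 j hj]
        have : (j' : ℝ) + 1 ≤ j := by exact_mod_cast h
        gcongr
  have hc2 : ((J.filter (fun j => ¬ neg j)).card : ℝ≥0∞) ≤ N := by
    rw [← hinj _ (Finset.filter_subset _ _)]
    apply hN
    · intro q hq
      obtain ⟨j, hj, rfl⟩ := Finset.mem_image.1 hq
      exact hp1 j (Finset.mem_filter.1 hj).1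
    · intro q hq q' hq' hne ⟨V, v1, v2, v3, v4⟩
      obtain ⟨j, hj, rfl⟩ := Finset.mem_image.1 hq
      obtain ⟨j', hj', rfl⟩ := Finset.mem_image.1 hq'
      obtain ⟨hj, hjn⟩ := Finset.mem_filter.1 hj
      obtain ⟨hj', hjn'⟩ := Finset.mem_filter.1 hj'
      rcases lt_trichotomy j j' with h | h | h
      · refine hjn' ⟨V, v1, v2, v4, p j, v3, ?_⟩
        rw [hp2 j hj]
        have : (j : ℝ) + 1 ≤ j' := by exact_mod_cast h
        have : (j : ℝ) ≤ j' - 1 := by linarith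
        gcongr
      · exact hne (by rw [h])
      · refine hjn ⟨V, v1, v2, v3, p j', v4, ?_⟩
        rw [hp2 j' hj']
        have : (j' : ℝ) + 1 ≤ j := by exact_mod_cast h
        have : (j' : ℝ) ≤ j - 1 := by linarith
        gcongr
  have := Finset.card_filter_add_card_filter_not (s := J) neg
  rw [← this, two_mul]
  push_cast
  exact add_le_add hc1 hc2

end Vis

namespace Vis

/-- Basic properties of the percolation. -/
structure Base {Ω : Type*} [MeasurableSpace Ω] (P : Measure Ω) (Z : Ω → Set UpperHalfPlane) :
    Prop where
  closed : ∀ ω, IsClosed (Z ω)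
  meas : ∀ K, IsCompact K → MeasurableSet {ω | Disjoint (Z ω) K}
  inv : ∀ (φ : UpperHalfPlane ≃ᵢ UpperHalfPlane) K, IsCompact K →
    P {ω | Disjoint (Z ω) K} = P {ω | Disjoint (Z ω) (φ '' K)}

/-- Properties of the percolation used in the proof (base point `I`). -/
structure Core {Ω : Type*} [MeasurableSpace Ω] (P : Measure Ω) (Z : Ω → Set UpperHalfPlane)
    (R₀ c : ℝ) (N : Ω → ℝ≥0∞) : Prop extends Base P Z where
  fkg : ∀ K K', IsCompact K → IsCompact K' →
    P.real {ω | Disjoint (Z ω) K} * P.real {ω | Disjoint (Z ω) K'} ≤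
      P.real {ω | Disjoint (Z ω) (K ∪ K')}
  R_pos : 0 < R₀
  indep : ∀ A B T T', Ev A T → Ev B T' → (∀ a ∈ A, ∀ b ∈ B, R₀ ≤ dist a b) →
    P.real {ω | Z ω ∈ T ∩ T'} = P.real {ω | Z ω ∈ T} * P.real {ω | Z ω ∈ T'}
  comp : ∀ᵐ ω ∂P, SepBound (Z ω) (N ω)
  exp : ∫⁻ ω, N ω ∂P < ∞
  c_pos : 0 < c
  decay : ∀ r : ℝ, 1 ≤ r → P.real {ω | axis '' Icc 0 r ⊆ Z ω} ≤ c * Real.exp (-r)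

section
variable {Ω : Type*} [MeasurableSpace Ω] {P : Measure Ω} [IsProbabilityMeasure P]
  {Z : Ω → Set UpperHalfPlane} {R₀ c : ℝ} {N : Ω → ℝ≥0∞}

lemma Base.measurable (h : Base P Z) : @Measurable _ _ _ (avoidS univ) Z := by
  refine measurable_generateFrom ?_
  rintro _ ⟨K, hK, -, rfl⟩
  exact h.meas K hK

lemma Base.measEv (h : Base P Z) {A T} (hT : Ev A T) : MeasurableSet {ω | Z ω ∈ T} := by
  obtain ⟨T', h1, h2⟩ := hT.mono (subset_univ A)
  have : {ω | Z ω ∈ T} = Z ⁻¹' T' := by ext ω; exact h2 _ (h.closed ω)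
  rw [this]; exact h.measurable h1

lemma Base.measurable_pre (h : Base P Z) (φ : UpperHalfPlane ≃ᵢ UpperHalfPlane) :
    @Measurable _ _ _ (avoidS univ) (fun ω => φ ⁻¹' Z ω) := by
  refine measurable_generateFrom ?_
  rintro _ ⟨K, hK, -, rfl⟩
  have := h.meas (φ '' K) (hK.image φ.continuous)
  refine (congrArg MeasurableSet ?_).mp this
  ext ω; exact (disjoint_preimage_iff φ _ K).symm

lemma Base.law (h : Base P Z) (φ : UpperHalfPlane ≃ᵢ UpperHalfPlane) {A T} (hT : Ev A T) :
    P {ω | φ ⁻¹' Z ω ∈ T} = P {ω | Z ω ∈ T} := by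
  obtain ⟨T', h1, h2⟩ := hT.mono (subset_univ A)
  have e1 : {ω | Z ω ∈ T} = Z ⁻¹' T' := by ext ω; exact h2 _ (h.closed ω)
  have e2 : {ω | φ ⁻¹' Z ω ∈ T} = (fun ω => φ ⁻¹' Z ω) ⁻¹' T' := by
    ext ω; exact h2 _ ((h.closed ω).preimage φ.continuous)
  rw [e1, e2]
  clear e1 e2 h2 hT T
  have m1 := h.measurable
  have m2 := h.measurable_pre φ
  induction T', h1 using MeasurableSpace.induction_on_inter (m := avoidS univ) rfl with
  | h_inter => 
    rintro _ ⟨K, hK, -, rfl⟩ _ ⟨K', hK', -, rfl⟩ -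
    refine ⟨K ∪ K', hK.union hK', subset_univ _, ?_⟩
    ext s; simp [disjoint_union_right]
  | empty => simp
  | basic t ht =>
    obtain ⟨K, hK, -, rfl⟩ := ht
    rw [show Z ⁻¹' {s | Disjoint s K} = {ω | Disjoint (Z ω) K} from rfl, h.inv φ K hK]
    congr 1; ext ω; exact disjoint_preimage_iff φ _ K
  | compl t ht ih =>
    rw [preimage_compl, preimage_compl, prob_compl_eq_one_sub (m2 ht),
      prob_compl_eq_one_sub (m1 ht), ih]
  | iUnion f hd hf ih =>
    rw [preimage_iUnion, preimage_iUnion, measure_iUnion _ fun i => m2 (hf i),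
      measure_iUnion _ fun i => m1 (hf i)]
    · exact tsum_congr ih
    · exact fun i j hij => (hd hij).preimage _
    · exact fun i j hij => (hd hij).preimage _

lemma Base.lawR (h : Base P Z) (φ : UpperHalfPlane ≃ᵢ UpperHalfPlane) {A T} (hT : Ev A T) :
    P.real {ω | φ ⁻¹' Z ω ∈ T} = P.real {ω | Z ω ∈ T} := by
  rw [measureReal_def, measureReal_def, h.law φ hT]

lemma Core.eps (h : Core P Z R₀ c N) : ∃ M' : ℝ, 0 < M' ∧ ∀ w : ℝ, 0 < w →
    P.real {ω | Z ω ∈ bD w} ≤ M' * w := by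
  classical
  set E := (∫⁻ ω, N ω ∂P).toReal with hE
  have hE0 : 0 ≤ E := ENNReal.toReal_nonneg
  refine ⟨8 * E + 4, by positivity, fun w hw => ?_⟩
  rcases le_or_gt w (1/4) with hw4 | hw4
  swap
  · have : P.real {ω | Z ω ∈ bD w} ≤ 1 := measureReal_le_one
    nlinarith
  set M := ⌊1 / (2 * w)⌋₊ with hM
  have hM1 : (M : ℝ) ≤ 1 / (2 * w) := Nat.floor_le (by positivity)
  have hM2 : 1 / (4 * w) ≤ M := by
    have h1 := Nat.lt_floor_add_one (1 / (2 * w))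
    have h2 : 1 ≤ 1 / (4 * w) := by rw [le_div_iff₀ (by positivity)]; linarith
    have h3 : 1 / (2 * w) = 2 * (1 / (4 * w)) := by field_simp; norm_num
    rw [← hM] at h1
    linarith
  have hMw : (M : ℝ) * w ≤ 1 / 2 := by
    calc (M : ℝ) * w ≤ 1 / (2 * w) * w := by gcongr
      _ = 1 / 2 := by field_simp
  let D : ℕ → Set Ω := fun j => {ω | tr (j * w) ⁻¹' Z ω ∈ bD w}
  have hD : ∀ j, MeasurableSet (D j) := fun j => h.measEv ((ev_bD w).map (tr (j * w)))
  have hPD : ∀ j, P (D j) = P {ω | Z ω ∈ bD w} := fun j => h.law _ (ev_bD w)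
  have key : ∀ᵐ ω ∂P, ∑ j ∈ Finset.range M, (D j).indicator 1 ω ≤ 2 * N ω := by
    filter_upwards [h.comp] with ω hω
    have h1 := count (Z ω) (h.closed ω) (N ω) hω w hw ((Finset.range M).filter fun j => ω ∈ D j)
      (by
        intro j hj
        have : (j : ℝ) ≤ M := by
          have := (Finset.mem_filter.1 hj).1; rw [Finset.mem_range] at this; exact_mod_cast this.le
        nlinarith) (fun j hj => (Finset.mem_filter.1 hj).2)
    refine le_trans (le_of_eq ?_) h1
    rw [Finset.card_filter]
    push_cast
    exact Finset.sum_congr rfl fun j _ => by simp [indicator_apply]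
  have h2 := lintegral_mono_ae key
  rw [lintegral_finsetSum _ (fun j _ => measurable_one.indicator (hD j))] at h2
  simp only [lintegral_indicator_one (hD _), hPD] at h2
  rw [lintegral_const_mul' _ _ (by simp), Finset.sum_const, Finset.card_range, nsmul_eq_mul] at h2
  have h3 := ENNReal.toReal_mono (ENNReal.mul_ne_top (by simp) h.exp.ne) h2
  rw [ENNReal.toReal_mul, ENNReal.toReal_mul, ← hE] at h3
  simp only [ENNReal.toReal_natCast, ENNReal.toReal_ofNat] at h3
  change (M : ℝ) * P.real {ω | Z ω ∈ bD w} ≤ 2 * E at h3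
  have h4 : 1 / (4 * w) * P.real {ω | Z ω ∈ bD w} ≤ 2 * E := by
    refine le_trans ?_ h3; gcongr
  rw [div_mul_eq_mul_div, one_mul, div_le_iff₀ (by positivity)] at h4
  nlinarith

/-! ### recursion -/

lemma sep_height {A B : Set UpperHalfPlane} {x y R : ℝ} (hR : R ≤ y - x)
    (hA : ∀ z ∈ A, z.im ≤ Real.exp x) (hB : ∀ z ∈ B, Real.exp y ≤ z.im) :
    ∀ a ∈ A, ∀ b ∈ B, R ≤ dist a b := by
  intro a ha b hb
  have h1 := UpperHalfPlane.dist_log_im_le a b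
  rw [Real.dist_eq, abs_sub_comm] at h1
  have h2 : Real.log a.im ≤ x := by
    rw [Real.log_le_iff_le_exp a.im_pos]; exact hA a ha
  have h3 : y ≤ Real.log b.im := by
    rw [Real.le_log_iff_exp_le b.im_pos]; exact hB b hb
  have := le_abs_self (Real.log b.im - Real.log a.im)
  linarith

lemma Core.seg (h : Core P Z R₀ c N) (n : ℕ) (hn : 5 ≤ n) :
    P.real {ω | axis '' Icc 2 ((n : ℝ) - 2) ⊆ Z ω} ≤ c * Real.exp 4 * Real.exp (-n) := by
  have hn' : (5 : ℝ) ≤ n := by exact_mod_cast hn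
  have h1 := h.decay (n - 4) (by linarith)
  rw [show (c * Real.exp (-((n:ℝ) - 4))) = c * Real.exp 4 * Real.exp (-n) by
    rw [mul_assoc, ← Real.exp_add]; congr 2; ring] at h1
  have h2 := h.lawR (sc 2) (A := univ) (T := {s | axis '' Icc 0 ((n:ℝ) - 4) ⊆ s})
    (Ev.subset (subset_univ _))
  refine le_trans (le_of_eq ?_) (h2.trans_le h1)
  congr 1
  ext ω
  simp only [mem_setOf_eq, image_subset_iff]
  constructor
  · intro H t ht
    show sc 2 (axis t) ∈ Z ω
    rw [sc_axis]
    exact H ⟨by linarith [ht.1], by linarith [ht.2]⟩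
  · intro H t ht
    have : sc 2 (axis (t - 2)) ∈ Z ω := H ⟨by linarith [ht.1], by linarith [ht.2]⟩
    rw [sc_axis] at this
    simpa using this

/-- Intermediate event. -/
def mE (δ : ℝ) (m n k : ℕ) : Set (Set UpperHalfPlane) :=
  (tS δ (k - m) ∩ {s | sc k ⁻¹' s ∈ bD (δ * Real.exp 4 * Real.exp (k - n))}) ∩
    {s | sc (k + m : ℕ) ⁻¹' s ∈ tS δ (n - (k + m))}

lemma Core.mE_prob (h : Core P Z R₀ c N) {δ : ℝ} (m n k : ℕ) (hm : R₀ + 2 ≤ m) :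
    P.real {ω | Z ω ∈ mE δ m n k} = P.real {ω | Z ω ∈ tS δ (k - m)} *
      P.real {ω | Z ω ∈ bD (δ * Real.exp 4 * Real.exp (k - n))} *
      P.real {ω | Z ω ∈ tS δ (n - (k + m))} := by
  have hR := h.R_pos
  have e1 := ev_tS δ (k - m)
  have e2 := (ev_bD (δ * Real.exp 4 * Real.exp (k - n))).map (sc k)
  have e3 := (ev_tS δ (n - (k + m))).map (sc (k + m : ℕ))
  have hb : ∀ z ∈ sc k '' bE, Real.exp ((k : ℝ) - 2) ≤ z.im ∧ z.im ≤ Real.exp ((k : ℝ) + 2) := by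
    rintro _ ⟨z, ⟨h1, h2, h3⟩, rfl⟩
    rw [sc_im, sub_eq_add_neg, Real.exp_add, Real.exp_add]
    constructor <;> gcongr
  have ht : ∀ z ∈ tE (k - m), z.im ≤ Real.exp ((k : ℝ) - m) := by
    rintro z hz
    rcases le_total m k with hk | hk
    · have := hz.2.1.le
      rwa [Nat.cast_sub hk] at this
    · rw [Nat.sub_eq_zero_of_le hk, tE_zero] at hz
      exact hz.elim
  have ht' : ∀ z ∈ sc (k + m : ℕ) '' tE (n - (k + m)), Real.exp ((k : ℝ) + m) ≤ z.im := by
    rintro _ ⟨z, ⟨h1, h2, h3⟩, rfl⟩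
    rw [sc_im]
    push_cast
    have := Real.exp_pos ((k : ℝ) + m)
    nlinarith
  have i1 := h.indep _ _ _ _ e1 e2 (sep_height (x := (k:ℝ) - m) (y := k - 2) (by linarith) ht
    fun z hz => (hb z hz).1)
  have i2 := h.indep _ _ _ _ ((e1.mono subset_union_left).inter (e2.mono subset_union_right)) e3
    (sep_height (x := (k:ℝ) + 2) (y := k + m) (by linarith) (by
      rintro z (hz | hz)
      · exact (ht z hz).trans (Real.exp_le_exp.2 (by linarith))
      · exact (hb z hz).2) ht')
  rw [mE, i2, i1]
  have l1 := h.lawR (sc k) (ev_bD (δ * Real.exp 4 * Real.exp (k - n)))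
  have l2 := h.lawR (sc (k + m : ℕ)) (ev_tS δ (n - (k + m)))
  rw [← l1, ← l2]
  rfl

lemma tS_sub {δ : ℝ} (hδ : 0 < δ) (m n : ℕ) (s) (hs : s ∈ tS δ n) (hn : 5 ≤ n) :
    axis '' Icc 2 ((n : ℝ) - 2) ⊆ s ∨ ∃ k ∈ Finset.range n, s ∈ mE δ m n k := by
  by_contra! H
  obtain ⟨H1, H2⟩ := H
  rw [not_subset] at H1
  obtain ⟨_, ⟨t, ht, rfl⟩, hts⟩ := H1
  set k := ⌊t + 1/2⌋₊ with hk
  have ht0 : 0 ≤ t + 1 / 2 := by linarith [ht.1]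
  have k1 : (k : ℝ) ≤ t + 1/2 := Nat.floor_le ht0
  have k2 : t + 1/2 < k + 1 := Nat.lt_floor_add_one _
  have k3 : 2 ≤ k := by
    rw [hk, Nat.le_floor_iff ht0]; push_cast; linarith [ht.1]
  have k4 : k + 2 ≤ n := by
    have : (k : ℝ) + 2 < n + 1 := by linarith [ht.2]
    have : k + 2 < n + 1 := by exact_mod_cast this
    omega
  refine H2 k (Finset.mem_range.2 (by omega)) ⟨⟨tS_left hδ (by omega) hs, ?_⟩, ?_⟩
  · exact tS_mid hδ k3 k4 hs (by rw [abs_le]; constructor <;> linarith) hts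
  · exact tS_right hs

lemma sum_exp (n : ℕ) : ∑ k ∈ Finset.range n, Real.exp ((k : ℝ) - n) ≤ 1 := by
  have h : ∀ n : ℕ, ∑ k ∈ Finset.range n, Real.exp (k : ℝ) ≤ Real.exp n := by
    intro n
    induction n with
    | zero => simp
    | succ n ih =>
      rw [Finset.sum_range_succ]
      push_cast
      rw [Real.exp_add]
      have := Real.exp_pos (n : ℝ)
      have h2 : 2 ≤ Real.exp 1 := by linarith [Real.exp_one_gt_d9]
      nlinarith
  simp_rw [Real.exp_sub, ← Finset.sum_div]
  rw [div_le_one (Real.exp_pos _)]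
  exact h n

lemma Core.tube (h : Core P Z R₀ c N) : ∃ δ K : ℝ, 0 < δ ∧ δ ≤ 1 / 2 ∧ 0 < K ∧
    ∀ n : ℕ, P.real {ω | Z ω ∈ tS δ n} ≤ K * Real.exp (-n) := by
  obtain ⟨M', hM', hM⟩ := h.eps
  obtain ⟨m, hm⟩ := exists_nat_ge (R₀ + 2)
  have hc := h.c_pos
  set K := 2 * c * Real.exp 4 + Real.exp 5 with hK
  have hK0 : 0 < K := by positivity
  set q := K * Real.exp (2 * m) * M' * Real.exp 4 with hq
  have hq0 : 0 < q := by positivity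
  set δ := min (1/2) (1 / (2 * q)) with hδ
  have hδ0 : 0 < δ := by positivity
  have hδq : q * δ ≤ 1 / 2 := by
    calc q * δ ≤ q * (1 / (2 * q)) := by gcongr; exact min_le_right _ _
      _ = 1 / 2 := by field_simp
  refine ⟨δ, K, hδ0, min_le_left _ _, hK0, fun n => ?_⟩
  induction n using Nat.strong_induction_on with
  | _ n ih =>
  rcases le_or_gt n 5 with hn | hn
  · have h1 : P.real {ω | Z ω ∈ tS δ n} ≤ 1 := measureReal_le_one
    refine h1.trans ?_
    rw [Real.exp_neg, ← div_eq_mul_inv, le_div_iff₀ (Real.exp_pos _), one_mul]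
    have : Real.exp n ≤ Real.exp 5 := Real.exp_le_exp.2 (by exact_mod_cast hn)
    have : 0 ≤ 2 * c * Real.exp 4 := by positivity
    linarith
  have step : P.real {ω | Z ω ∈ tS δ n} ≤ P.real {ω | axis '' Icc 2 ((n : ℝ) - 2) ⊆ Z ω} +
      ∑ k ∈ Finset.range n, P.real {ω | Z ω ∈ mE δ m n k} := by
    refine (measureReal_mono (s₂ := {ω | axis '' Icc 2 ((n : ℝ) - 2) ⊆ Z ω} ∪
      ⋃ k ∈ Finset.range n, {ω | Z ω ∈ mE δ m n k}) ?_).trans ?_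
    · intro ω hω
      rcases tS_sub hδ0 m n (Z ω) hω (by omega) with H | ⟨k, hk, H⟩
      · exact Or.inl H
      · exact Or.inr (mem_biUnion hk H)
    · refine (measureReal_union_le _ _).trans ?_
      gcongr
      exact measureReal_biUnion_finset_le _ _
  have hterm : ∀ k ∈ Finset.range n, P.real {ω | Z ω ∈ mE δ m n k} ≤
      (K * q * δ * Real.exp (-n)) * Real.exp ((k : ℝ) - n) := by
    intro k hk
    rw [Finset.mem_range] at hk
    rw [h.mE_prob m n k hm]
    have hs : ∀ a : ℝ, ∀ j : ℕ, j < n → a ≤ j → P.real {ω | Z ω ∈ tS δ j} ≤ K * Real.exp (-a) := by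
      intro a j hj ha
      refine (ih j hj).trans ?_
      gcongr
    have hmm : 2 < (m : ℝ) := by linarith [h.R_pos]
    have hmm' : 2 < m := by exact_mod_cast hmm
    have a1 := hs (k - m) (k - m) (by omega) (by
      have : k ≤ k - m + m := by omega
      have : (k : ℝ) ≤ (k - m : ℕ) + m := by exact_mod_cast this
      linarith)
    have a2 := hs (n - (k + m)) (n - (k + m)) (by omega) (by
      have : n ≤ n - (k + m) + (k + m) := by omega
      have : (n : ℝ) ≤ (n - (k + m) : ℕ) + (k + m) := by exact_mod_cast this
      linarith)
    have a3 := hM (δ * Real.exp 4 * Real.exp (k - n)) (by positivity)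
    calc _ ≤ (K * Real.exp (-((k:ℝ) - m))) * (M' * (δ * Real.exp 4 * Real.exp (k - n))) *
          (K * Real.exp (-((n:ℝ) - (k + m)))) := by gcongr
      _ = (K * (K * (Real.exp (-((k:ℝ) - m)) * Real.exp (-((n:ℝ) - (k + m)))) * M' * Real.exp 4) * δ)
            * Real.exp ((k : ℝ) - n) := by ring
      _ = _ := by
        have : Real.exp (-((k:ℝ) - m)) * Real.exp (-((n:ℝ) - (k + m))) =
            Real.exp (2 * m) * Real.exp (-n) := by
          rw [← Real.exp_add, ← Real.exp_add]; congr 1; ring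
        rw [this, hq]; ring
  have hsum : ∑ k ∈ Finset.range n, P.real {ω | Z ω ∈ mE δ m n k} ≤ K / 2 * Real.exp (-n) := by
    refine (Finset.sum_le_sum hterm).trans ?_
    rw [← Finset.mul_sum]
    have e0 := Real.exp_pos (-(n:ℝ))
    calc _ ≤ (K * q * δ * Real.exp (-n)) * 1 := by gcongr; exact sum_exp n
      _ = K * (q * δ) * Real.exp (-n) := by ring
      _ ≤ K * (1 / 2) * Real.exp (-n) := by gcongr
      _ = _ := by ring
  have hseg := h.seg n (by omega)
  have e0 := Real.exp_pos (-(n:ℝ))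
  have e5 := Real.exp_pos (5:ℝ)
  refine step.trans ((add_le_add hseg hsum).trans ?_)
  rw [← add_mul]
  gcongr
  linarith

end
end Vis

namespace Vis

section
variable {Ω : Type*} [MeasurableSpace Ω] {P : Measure Ω} [IsProbabilityMeasure P]
  {Z : Ω → Set UpperHalfPlane} {R₀ c : ℝ} {N : Ω → ℝ≥0∞}

lemma Core.fkg_fin (h : Core P Z R₀ c N) {ι : Type*} (F : Finset ι) (K : ι → Set UpperHalfPlane)
    (hK : ∀ i, IsCompact (K i)) (b : ℝ) (hb : 0 ≤ b)
    (hbK : ∀ i ∈ F, b ≤ P.real {ω | Disjoint (Z ω) (K i)}) :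
    b ^ F.card ≤ P.real {ω | Disjoint (Z ω) (⋃ i ∈ F, K i)} := by
  classical
  induction F using Finset.induction_on with
  | empty => simp
  | insert a F ha ih =>
    rw [Finset.card_insert_of_notMem ha, Finset.set_biUnion_insert, pow_succ']
    refine le_trans ?_ (h.fkg _ _ (hK a) (F.isCompact_biUnion fun i _ => hK i))
    have h1 := hbK a (Finset.mem_insert_self _ _)
    have h2 := ih fun i hi => hbK i (Finset.mem_insert_of_mem hi)
    gcongr

lemma Core.small (h : Core P Z R₀ c N) : ∃ z : UpperHalfPlane, ∃ r > 0,
    0 < P.real {ω | Disjoint (Z ω) (Metric.closedBall z r)} := by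
  by_contra! H
  have h0 : ∀ z : UpperHalfPlane, ∀ r > 0, ∀ᵐ ω ∂P, ¬ Disjoint (Z ω) (Metric.closedBall z r) := by
    intro z r hr
    have h1 := le_antisymm (H z r hr) measureReal_nonneg
    rw [measureReal_eq_zero_iff] at h1
    rw [ae_iff]
    simpa using h1
  have h1 : ∀ᵐ ω ∂P, ∀ i j : ℕ, ¬ Disjoint (Z ω)
      (Metric.closedBall (TopologicalSpace.denseSeq UpperHalfPlane i) (1 / ((j : ℝ) + 1))) :=
    ae_all_iff.2 fun i => ae_all_iff.2 fun j => h0 _ _ (by positivity)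
  have h2 : ∀ᵐ ω ∂P, Z ω = univ := by
    filter_upwards [h1] with ω hω
    rw [← (h.closed ω).closure_eq, ← dense_iff_closure_eq, Metric.dense_iff]
    intro x r hr
    obtain ⟨j, hj⟩ := exists_nat_one_div_lt (half_pos hr)
    obtain ⟨i, hi⟩ := (TopologicalSpace.denseRange_denseSeq UpperHalfPlane).exists_dist_lt x
      (half_pos hr)
    obtain ⟨y, hy1, hy2⟩ := not_disjoint_iff.1 (hω i j)
    refine ⟨y, ?_, hy1⟩
    rw [Metric.mem_closedBall] at hy2
    rw [Metric.mem_ball, ]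
    have := dist_triangle_right y x (TopologicalSpace.denseSeq UpperHalfPlane i)
    linarith
  have h3 : ∀ r : ℝ, P.real {ω | axis '' Icc 0 r ⊆ Z ω} = 1 := by
    intro r
    have : P {ω | axis '' Icc 0 r ⊆ Z ω} = 1 := by
      rw [← measure_univ (μ := P)]
      apply measure_congr
      filter_upwards [h2] with ω hω
      apply propext
      constructor
      · intro _; trivial
      · intro _
        show axis '' Icc 0 r ⊆ Z ω
        rw [hω]; exact subset_univ _
    rw [measureReal_def, this]; simp
  have hc := h.c_pos
  have h4 := h.decay (c + 1) (by linarith)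
  rw [h3, Real.exp_neg, ← div_eq_mul_inv, le_div_iff₀ (Real.exp_pos _)] at h4
  linarith [Real.add_one_le_exp (c + 1)]

lemma Core.inv_ball (h : Core P Z R₀ c N) (x y : UpperHalfPlane) (r : ℝ) :
    P.real {ω | Disjoint (Z ω) (Metric.closedBall x r)} =
      P.real {ω | Disjoint (Z ω) (Metric.closedBall y r)} := by
  obtain ⟨φ, hφ⟩ := exists_iso x
  obtain ⟨ψ, hψ⟩ := exists_iso y
  have h1 := h.inv φ _ (isCompact_closedBall UpperHalfPlane.I r)
  have h2 := h.inv ψ _ (isCompact_closedBall UpperHalfPlane.I r)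
  rw [IsometryEquiv.image_closedBall, hφ] at h1
  rw [IsometryEquiv.image_closedBall, hψ] at h2
  rw [measureReal_def, measureReal_def, ← h1, ← h2]

lemma Core.beta (h : Core P Z R₀ c N) (ρ : ℝ) :
    0 < P.real {ω | Disjoint (Z ω) (Metric.closedBall UpperHalfPlane.I ρ)} := by
  obtain ⟨z, r, hr, hz⟩ := h.small
  obtain ⟨F, -, hF⟩ := (isCompact_closedBall UpperHalfPlane.I ρ).elim_nhds_subcover
    (fun x => Metric.closedBall x r) (fun x _ => Metric.closedBall_mem_nhds x hr)
  have h1 := h.fkg_fin F (fun x => Metric.closedBall x r) (fun x => isCompact_closedBall x r) _ hz.le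
    (fun x _ => (h.inv_ball z x r).le)
  refine (pow_pos hz _).trans_le (h1.trans (measureReal_mono ?_))
  intro ω hω
  exact Disjoint.mono_right hF hω

lemma markov (I : Finset ℕ) (D : ℕ → Set Ω) (hD : ∀ j, MeasurableSet (D j)) (Q : ℕ) (g : ℝ)
    (hg : ∀ j ∈ I, P.real (D j) ≤ g) [∀ ω, DecidablePred fun j => ω ∈ D j] :
    Q * P.real {ω | Q ≤ (I.filter fun j => ω ∈ D j).card} ≤ I.card * g := by
  have e : ∀ ω, ((I.filter fun j => ω ∈ D j).card : ℝ) =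
      ∑ j ∈ I, (D j).indicator (fun _ => (1 : ℝ)) ω := by
    intro ω
    rw [Finset.card_filter]
    push_cast
    exact Finset.sum_congr rfl fun j _ => by simp [indicator_apply]
  have hi : ∀ j ∈ I, Integrable ((D j).indicator (fun _ => (1 : ℝ))) P :=
    fun j _ => (integrable_const 1).indicator (hD j)
  have h1 := mul_meas_ge_le_integral_of_nonneg (μ := P)
    (f := fun ω => ∑ j ∈ I, (D j).indicator (fun _ => (1 : ℝ)) ω)
    (Filter.Eventually.of_forall fun ω => Finset.sum_nonneg fun j _ =>
      indicator_nonneg (fun _ _ => zero_le_one) _) (integrable_finsetSum _ hi) (Q : ℝ)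
  rw [integral_finsetSum _ hi] at h1
  simp only [integral_indicator_const _ (hD _), smul_eq_mul, mul_one, ← e, Nat.cast_le] at h1
  refine h1.trans ?_
  rw [← nsmul_eq_mul]
  exact Finset.sum_le_card_nsmul _ _ _ hg

/-- Visible configurations. -/
def vis (s : Set UpperHalfPlane) : Prop :=
  ∃ φ : ℝ, -Real.pi < φ ∧ φ ≤ Real.pi ∧ ∀ t : ℝ, 0 ≤ t → rot φ (axis t) ∈ s

/-- Net of angles. -/
noncomputable def ang (M j : ℕ) : ℝ := -Real.pi + 2 * Real.pi * j / M

lemma ang_near (M : ℕ) (ε φ : ℝ) (hM : 0 < M) (hε : 2 * Real.pi / M ≤ ε) (h1 : -Real.pi < φ)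
    (h2 : φ ≤ Real.pi) : ∃ j ∈ Finset.range (M + 1), |φ - ang M j| ≤ ε := by
  have hpi := Real.pi_pos
  have hM' : (0 : ℝ) < M := by exact_mod_cast hM
  have h0 : 0 ≤ (φ + Real.pi) * M / (2 * Real.pi) := by
    have : 0 ≤ φ + Real.pi := by linarith
    positivity
  set j := ⌊(φ + Real.pi) * M / (2 * Real.pi)⌋₊ with hj
  have j1 : (j : ℝ) ≤ (φ + Real.pi) * M / (2 * Real.pi) := Nat.floor_le h0
  have j2 : (φ + Real.pi) * M / (2 * Real.pi) < j + 1 := Nat.lt_floor_add_one _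
  rw [le_div_iff₀ (by positivity)] at j1
  rw [div_lt_iff₀ (by positivity)] at j2
  refine ⟨j, ?_, ?_⟩
  · rw [Finset.mem_range]
    have : (j : ℝ) ≤ M := by
      have : (j : ℝ) * (2 * Real.pi) ≤ M * (2 * Real.pi) := by nlinarith
      exact le_of_mul_le_mul_right this (by positivity)
    have : j ≤ M := by exact_mod_cast this
    omega
  · refine le_trans ?_ hε
    have e : φ - ang M j = ((φ + Real.pi) * M - j * (2 * Real.pi)) / M := by
      unfold ang; field_simp; ring
    rw [e, abs_of_nonneg (div_nonneg (by linarith) hM'.le)]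
    gcongr
    linarith

lemma Core.step (h : Core P Z R₀ c N) (hp : 0 < P.real {ω | vis (Z ω)}) :
    ∃ η : ℝ, 0 < η ∧ ∀ (ρ₀ : ℝ) T, Ev (Metric.closedBall UpperHalfPlane.I ρ₀) T →
      {ω | vis (Z ω)} ⊆ {ω | Z ω ∈ T} → ∃ (ρ₁ : ℝ) (T' : _),
      Ev (Metric.closedBall UpperHalfPlane.I ρ₁) T' ∧ {ω | vis (Z ω)} ⊆ {ω | Z ω ∈ T'} ∧
        P.real {ω | Z ω ∈ T'} ≤ P.real {ω | Z ω ∈ T} - η := by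
  classical
  obtain ⟨δ, K, hδ, hδ', hK, hG⟩ := h.tube
  have hR := h.R_pos
  set p := P.real {ω | vis (Z ω)} with hpdef
  set b := R₀ + 3 with hb
  set β := P.real {ω | Disjoint (Z ω) (Metric.closedBall UpperHalfPlane.I (2 * b + 2))} with hβ
  have hβ0 : 0 < β := h.beta _
  have hβ1 : β ≤ 1 := measureReal_le_one
  have hpi := Real.pi_pos
  set M0 := (4 * Real.pi / δ + 2) * K with hM0
  have hM00 : 0 < M0 := by positivity
  obtain ⟨Q, hQ⟩ := exists_nat_gt (2 * M0 / p)
  have hQ0 : (0 : ℝ) < Q := lt_trans (by positivity) hQ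
  refine ⟨β ^ Q * (p / 2), by positivity, fun ρ₀ T hT hFT => ?_⟩
  obtain ⟨n, hn⟩ := exists_nat_ge ρ₀
  set τ : ℝ := n + b with hτ
  have hτ0 : 0 ≤ τ := by positivity
  set κ := Metric.closedBall (axis τ) (2 * b + 2) ∩ Metric.sphere UpperHalfPlane.I τ with hκ
  have hκc : IsCompact κ := (isCompact_closedBall _ _).inter_right Metric.isClosed_sphere
  set M := ⌈4 * Real.pi * Real.exp n / δ⌉₊ with hM
  have hM1 : 4 * Real.pi * Real.exp n / δ ≤ M := Nat.le_ceil _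
  have hM2 : (M : ℝ) < 4 * Real.pi * Real.exp n / δ + 1 := Nat.ceil_lt_add_one (by positivity)
  have hMr : (0 : ℝ) < M := lt_of_lt_of_le (by positivity) hM1
  have hM0' : 0 < M := by exact_mod_cast hMr
  have hMε : 2 * Real.pi / M ≤ δ * Real.exp (-n) / 2 := by
    rw [div_le_iff₀ hMr]
    rw [div_le_iff₀ hδ] at hM1
    have e1 : Real.exp (-(n:ℝ)) * Real.exp n = 1 := by rw [← Real.exp_add]; simp
    have e0 := Real.exp_pos (-(n:ℝ))
    have : Real.exp (-(n:ℝ)) * (4 * Real.pi * Real.exp n) ≤ Real.exp (-(n:ℝ)) * (M * δ) := by gcongr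
    have e2 : Real.exp (-(n:ℝ)) * (4 * Real.pi * Real.exp n) = 4 * Real.pi := by
      linear_combination 4 * Real.pi * e1
    rw [e2] at this
    linarith
  let Sv : ℕ → Set (Set UpperHalfPlane) := fun j => {s | rot (ang M j) ⁻¹' s ∈ tS δ n}
  have hrotball : ∀ a ρ, rot a '' Metric.closedBall UpperHalfPlane.I ρ =
      Metric.closedBall UpperHalfPlane.I ρ := by
    intro a ρ; rw [IsometryEquiv.image_closedBall, rot_I]
  have hSv : ∀ j, Ev (Metric.closedBall UpperHalfPlane.I (n + 3)) (Sv j) := by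
    intro j
    refine ((ev_tS δ n).map (rot (ang M j))).mono ?_
    rw [← hrotball (ang M j)]
    exact image_mono (tE_sub_ball n)
  let I := Finset.range (M + 1)
  let X : Finset ℕ → Set (Set UpperHalfPlane) := fun J => T ∩ ⋂ j : I, {s | s ∈ Sv j ↔ j.1 ∈ J}
  have hX : ∀ J, Ev (Metric.closedBall UpperHalfPlane.I (n + 3)) (X J) := by
    intro J
    refine (hT.mono (Metric.closedBall_subset_closedBall (by linarith))).inter (Ev.iInter fun j => ?_)
    by_cases hj : j.1 ∈ J
    · exact (hSv j).congr fun s _ => by simp [hj]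
    · exact (hSv j).compl.congr fun s _ => by simp [hj]
  let κ' : ℕ → Set UpperHalfPlane := fun j => rot (ang M j) '' κ
  have hκ' : ∀ j, IsCompact (κ' j) := fun j => hκc.image (rot _).continuous
  have hκs : ∀ j, κ' j ⊆ Metric.sphere UpperHalfPlane.I τ := by
    rintro j _ ⟨z, hz, rfl⟩
    have := hz.2
    rw [Metric.mem_sphere] at this ⊢
    rw [← this, ← (rot (ang M j)).dist_eq z, rot_I]
  let Kl : Finset ℕ → Set (Set UpperHalfPlane) := fun J => {s | Disjoint s (⋃ j ∈ J, κ' j)}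
  have hKl : ∀ J, Ev (Metric.sphere UpperHalfPlane.I τ) (Kl J) := fun J =>
    Ev.disj (J.isCompact_biUnion fun j _ => hκ' j) (iUnion₂_subset fun j _ => hκs j)
  have hKlp : ∀ J : Finset ℕ, J.card ≤ Q → β ^ Q ≤ P.real {ω | Z ω ∈ Kl J} := by
    intro J hJ
    refine (pow_le_pow_of_le_one hβ0.le hβ1 hJ).trans (h.fkg_fin J κ' hκ' β hβ0.le fun j _ => ?_)
    have e1 := h.inv (rot (ang M j)) κ hκc
    rw [measureReal_def, ← e1, ← measureReal_def, hβ, h.inv_ball _ (axis τ)]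
    exact measureReal_mono fun ω hω => Disjoint.mono_right inter_subset_left hω
  have hXK : ∀ J, P.real {ω | Z ω ∈ X J ∩ Kl J} = P.real {ω | Z ω ∈ X J} * P.real {ω | Z ω ∈ Kl J} := by
    intro J
    refine h.indep _ _ _ _ (hX J) (hKl J) ?_
    intro a ha z hz
    rw [Metric.mem_closedBall] at ha
    rw [Metric.mem_sphere] at hz
    have := dist_triangle_left z UpperHalfPlane.I a
    linarith
  let S := I.powerset.filter fun J => J.card ≤ Q
  have hXdisj : ∀ J ∈ S, ∀ J' ∈ S, ∀ s, s ∈ X J → s ∈ X J' → J = J' := by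
    intro J hJ J' hJ' s hs hs'
    have sJ := Finset.mem_powerset.1 (Finset.mem_filter.1 hJ).1
    have sJ' := Finset.mem_powerset.1 (Finset.mem_filter.1 hJ').1
    have a1 := fun j : I => mem_iInter.1 hs.2 j
    have a2 := fun j : I => mem_iInter.1 hs'.2 j
    ext j
    constructor
    · intro hj; exact (a2 ⟨j, sJ hj⟩).1 ((a1 ⟨j, sJ hj⟩).2 hj)
    · intro hj; exact (a1 ⟨j, sJ' hj⟩).1 ((a2 ⟨j, sJ' hj⟩).2 hj)
  let U : Set (Set UpperHalfPlane) := ⋃ J : S, (X J ∩ Kl J)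
  have hball : ∀ J, Ev (Metric.closedBall UpperHalfPlane.I τ) (X J ∩ Kl J) := fun J =>
    ((hX J).mono (Metric.closedBall_subset_closedBall (by linarith))).inter
      ((hKl J).mono Metric.sphere_subset_closedBall)
  have hU : Ev (Metric.closedBall UpperHalfPlane.I τ) U := Ev.iUnion fun J => hball J
  have hUT : U ⊆ T := iUnion_subset fun J s hs => hs.1.1
  have hsumX : P.real {ω | Z ω ∈ T} ≤ ∑ J ∈ S, P.real {ω | Z ω ∈ X J} +
      P.real {ω | Q ≤ (I.filter fun j => ω ∈ {ω | Z ω ∈ Sv j}).card} := by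
    refine le_trans (measureReal_mono (s₂ := (⋃ J ∈ S, {ω | Z ω ∈ X J}) ∪
      {ω | Q ≤ (I.filter fun j => ω ∈ {ω | Z ω ∈ Sv j}).card}) ?_) ?_
    · intro ω hω
      by_cases hc : Q ≤ (I.filter fun j => ω ∈ {ω | Z ω ∈ Sv j}).card
      · exact Or.inr hc
      · refine Or.inl (mem_biUnion (x := I.filter fun j => ω ∈ {ω | Z ω ∈ Sv j}) ?_ ?_)
        · exact Finset.mem_coe.2 (Finset.mem_filter.2
            ⟨Finset.mem_powerset.2 (Finset.filter_subset _ _), (not_le.1 hc).le⟩)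
        · refine ⟨hω, mem_iInter.2 fun j => ?_⟩
          show _ ↔ _
          rw [Finset.mem_filter]
          exact ⟨fun H => ⟨j.2, H⟩, fun H => H.2⟩
    · refine (measureReal_union_le _ _).trans ?_
      gcongr
      exact measureReal_biUnion_finset_le _ _
  have hMk := markov (P := P) I (fun j => {ω | Z ω ∈ Sv j}) (fun j => h.measEv (hSv j)) Q
    (K * Real.exp (-n)) (fun j _ => (h.lawR (rot (ang M j)) (ev_tS δ n)).trans_le (hG n))
  have hMk2 : (I.card : ℝ) * (K * Real.exp (-n)) ≤ M0 := by
    have hI : (I.card : ℝ) = M + 1 := by simp [I]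
    have e1 : Real.exp (n:ℝ) * Real.exp (-(n:ℝ)) = 1 := by rw [← Real.exp_add]; simp
    have e0 := Real.exp_pos (-(n:ℝ))
    have e2 : Real.exp (-(n:ℝ)) ≤ 1 := by rw [Real.exp_le_one_iff]; simp
    rw [hI]
    calc ((M:ℝ) + 1) * (K * Real.exp (-n)) ≤
          (4 * Real.pi * Real.exp n / δ + 2) * (K * Real.exp (-n)) :=
            mul_le_mul_of_nonneg_right (by linarith) (by positivity)
      _ = (4 * Real.pi / δ * (Real.exp n * Real.exp (-n)) + 2 * Real.exp (-n)) * K := by ring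
      _ ≤ (4 * Real.pi / δ * 1 + 2 * 1) * K := by rw [e1]; gcongr
      _ = M0 := by rw [hM0]; ring
  have hMk3 : P.real {ω | Q ≤ (I.filter fun j => ω ∈ {ω | Z ω ∈ Sv j}).card} ≤ p / 2 := by
    have h1 := hMk.trans hMk2
    rw [div_lt_iff₀ hp] at hQ
    have : (Q : ℝ) * P.real {ω | Q ≤ (I.filter fun j => ω ∈ {ω | Z ω ∈ Sv j}).card} ≤ Q * (p / 2) := by
      linarith
    exact le_of_mul_le_mul_left this hQ0
  have hPT : p ≤ P.real {ω | Z ω ∈ T} := measureReal_mono hFT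
  have hPU : P.real {ω | Z ω ∈ U} = ∑ J ∈ S, P.real {ω | Z ω ∈ X J ∩ Kl J} := by
    have e : {ω | Z ω ∈ U} = ⋃ J ∈ S, {ω | Z ω ∈ X J ∩ Kl J} := by
      ext ω; simp [U]
    rw [e, measureReal_biUnion_finset]
    · intro J hJ J' hJ' hne
      refine disjoint_left.2 fun ω h1 h2 => hne (hXdisj J hJ J' hJ' (Z ω) h1.1 h2.1)
    · intro J _
      exact h.measEv (hball J)
  have hPU2 : β ^ Q * (p / 2) ≤ P.real {ω | Z ω ∈ U} := by
    rw [hPU]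
    calc β ^ Q * (p / 2) ≤ β ^ Q * ∑ J ∈ S, P.real {ω | Z ω ∈ X J} := by gcongr; linarith
      _ ≤ _ := by
        rw [Finset.mul_sum]
        refine Finset.sum_le_sum fun J hJ => ?_
        rw [hXK, mul_comm]
        gcongr
        exact hKlp J (Finset.mem_filter.1 hJ).2
  refine ⟨τ, T ∩ Uᶜ, (hT.mono (Metric.closedBall_subset_closedBall (by linarith))).inter hU.compl,
    ?_, ?_⟩
  · intro ω hω
    refine ⟨hFT hω, ?_⟩
    intro hUω
    obtain ⟨J, hXJ, hKJ⟩ := mem_iUnion.1 hUω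
    obtain ⟨φ, h1, h2, hray⟩ := hω
    obtain ⟨j, hj, hφ⟩ := ang_near M _ φ hM0' hMε h1 h2
    have hr : ∀ t : ℝ, rot (ang M j) (rot (φ - ang M j) (axis t)) = rot φ (axis t) := by
      intro t; rw [← rot_add]; congr 2; ring
    have hsv : Z ω ∈ Sv j := by
      rintro ⟨C, C1, C2, C3, C4, C5, C6⟩
      refine sep δ hδ hδ' n (φ - ang M j) hφ (rot (ang M j) ⁻¹' Z ω) ?_ C C2 C3 C4 C5 C6
      intro t ht
      show rot _ _ ∈ Z ω
      rw [hr]; exact hray t ht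
    have hjJ : j ∈ J.1 := (mem_iInter.1 hXJ.2 ⟨j, hj⟩).1 hsv
    have hmem : rot (φ - ang M j) (axis τ) ∈ κ := by
      refine ⟨Metric.mem_closedBall.2 (kill_near n δ b _ hδ hδ' (by linarith) hφ), ?_⟩
      rw [Metric.mem_sphere]
      nth_rewrite 1 [← rot_I (φ - ang M j)]
      rw [IsometryEquiv.dist_eq, dist_axis_I τ hτ0]
    have hd : Disjoint (Z ω) (⋃ j ∈ J.1, κ' j) := hKJ
    refine disjoint_left.1 hd (hray τ hτ0) (mem_biUnion (x := j) hjJ ⟨_, hmem, hr τ⟩)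
  · have e : {ω | Z ω ∈ T ∩ Uᶜ} = {ω | Z ω ∈ T} \ {ω | Z ω ∈ U} := rfl
    have hsub : {ω | Z ω ∈ U} ⊆ {ω | Z ω ∈ T} := fun ω hω => hUT hω
    rw [e, measureReal_diff hsub (h.measEv hU)]
    linarith

lemma Core.main (h : Core P Z R₀ c N) : P {ω | vis (Z ω)} = 0 := by
  by_contra hne
  have hp : 0 < P.real {ω | vis (Z ω)} :=
    lt_of_le_of_ne measureReal_nonneg (Ne.symm (by rwa [Ne, measureReal_eq_zero_iff]))
  obtain ⟨η, hη, hstep⟩ := h.step hp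
  have it : ∀ k : ℕ, ∃ (ρ : ℝ) (T : _), Ev (Metric.closedBall UpperHalfPlane.I ρ) T ∧
      {ω | vis (Z ω)} ⊆ {ω | Z ω ∈ T} ∧ P.real {ω | Z ω ∈ T} ≤ 1 - k * η := by
    intro k
    induction k with
    | zero => exact ⟨0, univ, Ev.univ, fun _ _ => trivial, by simp⟩
    | succ k ih =>
      obtain ⟨ρ, T, h1, h2, h3⟩ := ih
      obtain ⟨ρ', T', h4, h5, h6⟩ := hstep ρ T h1 h2
      refine ⟨ρ', T', h4, h5, ?_⟩
      push_cast
      linarith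
  obtain ⟨k, hk⟩ := exists_nat_gt (1 / η)
  obtain ⟨ρ, T, -, -, h3⟩ := it k
  rw [div_lt_iff₀ hη] at hk
  have : 0 ≤ P.real {ω | Z ω ∈ T} := measureReal_nonneg
  linarith

end
end Vis

namespace Vis

section
variable {Ω : Type*} [MeasurableSpace Ω] {P : Measure Ω} [IsProbabilityMeasure P]
  {Z : Ω → Set UpperHalfPlane}

lemma effros_meas {K : Set UpperHalfPlane} (hK : IsCompact K) :
    MeasurableSet[effrosSigma UpperHalfPlane] {s | (s ∩ K).Nonempty} :=
  MeasurableSpace.measurableSet_generateFrom ⟨K, hK, rfl⟩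

lemma disj_eq (Z : Ω → Set UpperHalfPlane) (K : Set UpperHalfPlane) :
    {ω | Disjoint (Z ω) K} = {ω | (Z ω ∩ K).Nonempty}ᶜ := by
  ext ω; simp [disjoint_iff_inter_eq_empty, not_nonempty_iff_eq_empty]

lemma base_of (hZclosed : ∀ ω, IsClosed (Z ω))
    (hZmeas : @Measurable Ω (Set UpperHalfPlane) _ (effrosSigma UpperHalfPlane) Z)
    (hinv : ∀ (φ : UpperHalfPlane ≃ᵢ UpperHalfPlane) (K : Set UpperHalfPlane),
      IsCompact K → P {ω | (Z ω ∩ K).Nonempty} = P {ω | (Z ω ∩ φ '' K).Nonempty}) : Base P Z := by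
  have hm : ∀ K, IsCompact K → MeasurableSet {ω | (Z ω ∩ K).Nonempty} :=
    fun K hK => hZmeas (effros_meas hK)
  refine ⟨hZclosed, fun K hK => ?_, fun φ K hK => ?_⟩
  · rw [disj_eq]; exact (hm K hK).compl
  · rw [disj_eq, disj_eq, prob_compl_eq_one_sub (hm K hK),
      prob_compl_eq_one_sub (hm _ (hK.image φ.continuous)), hinv φ K hK]

lemma Base.pull (h : Base P Z) (ψ : UpperHalfPlane ≃ᵢ UpperHalfPlane) :
    Base P (fun ω => ψ ⁻¹' Z ω) := by
  refine ⟨fun ω => (h.closed ω).preimage ψ.continuous, fun K hK => ?_, fun φ K hK => ?_⟩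
  · simp only [disjoint_preimage_iff]; exact h.meas _ (hK.image ψ.continuous)
  · simp only [disjoint_preimage_iff]
    rw [h.inv ((ψ.symm.trans φ).trans ψ) _ (hK.image ψ.continuous)]
    have : ((ψ.symm.trans φ).trans ψ) '' (ψ '' K) = ψ '' (φ '' K) := by
      simp [image_image]
    rw [this]

lemma fkg_of (h : Base P Z)
    (hFKG : ∀ g h : Set UpperHalfPlane → ℝ,
      Monotone g → Monotone h →
      @Measurable (Set UpperHalfPlane) ℝ (effrosSigma UpperHalfPlane) _ g →
      @Measurable (Set UpperHalfPlane) ℝ (effrosSigma UpperHalfPlane) _ h →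
      (∃ M, ∀ s, |g s| ≤ M) → (∃ M, ∀ s, |h s| ≤ M) →
      (∫ ω, g (Z ω) ∂P) * (∫ ω, h (Z ω) ∂P) ≤ ∫ ω, g (Z ω) * h (Z ω) ∂P)
    (K K' : Set UpperHalfPlane) (hK : IsCompact K) (hK' : IsCompact K') :
    P.real {ω | Disjoint (Z ω) K} * P.real {ω | Disjoint (Z ω) K'} ≤
      P.real {ω | Disjoint (Z ω) (K ∪ K')} := by
  classical
  let g : Set UpperHalfPlane → Set UpperHalfPlane → ℝ := fun K s =>
    {s | (s ∩ K).Nonempty}.indicator (fun _ => (1 : ℝ)) s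
  have gmono : ∀ K, Monotone (g K) := by
    intro K s t hst
    by_cases hs : (s ∩ K).Nonempty
    · have ht : (t ∩ K).Nonempty := hs.mono (inter_subset_inter_left _ hst)
      simp [g, indicator_apply, hs, ht]
    · simp only [g, indicator_apply, mem_setOf_eq, hs, if_false]
      split_ifs <;> simp
  have gmeas : ∀ K, IsCompact K → @Measurable _ ℝ (effrosSigma UpperHalfPlane) _ (g K) :=
    fun K hK => by
      letI := effrosSigma UpperHalfPlane
      exact (measurable_const (a := (1:ℝ))).indicator (effros_meas hK)
  have gb : ∀ K, ∃ M, ∀ s, |g K s| ≤ M := by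
    intro K
    refine ⟨1, fun s => ?_⟩
    simp only [g, indicator_apply]
    split_ifs <;> simp
  have key := hFKG (g K) (g K') (gmono K) (gmono K') (gmeas K hK) (gmeas K' hK') (gb K) (gb K')
  have m1 := h.meas K hK
  have m2 := h.meas K' hK'
  have e : ∀ K ω, g K (Z ω) = {ω | Disjoint (Z ω) K}ᶜ.indicator (fun _ => (1:ℝ)) ω := by
    intro K ω
    simp only [g, indicator_apply, disj_eq, compl_compl]
    rfl
  have e2 : ∀ ω, g K (Z ω) * g K' (Z ω) =
      ({ω | Disjoint (Z ω) K}ᶜ ∩ {ω | Disjoint (Z ω) K'}ᶜ).indicator (fun _ => (1:ℝ)) ω := by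
    intro ω
    rw [e, e]
    simp only [indicator_apply, mem_inter_iff]
    split_ifs <;> simp_all
  simp only [e2] at key
  simp only [e] at key
  rw [integral_indicator_const _ m1.compl, integral_indicator_const _ m2.compl,
    integral_indicator_const _ (m1.compl.inter m2.compl), ← compl_union,
    probReal_compl_eq_one_sub m1, probReal_compl_eq_one_sub m2,
    probReal_compl_eq_one_sub (m1.union m2)] at key
  simp only [smul_eq_mul, mul_one] at key
  have hu := measureReal_union_add_inter (μ := P) (s := {ω | Disjoint (Z ω) K}) m2
  have hi : {ω | Disjoint (Z ω) K} ∩ {ω | Disjoint (Z ω) K'} = {ω | Disjoint (Z ω) (K ∪ K')} := by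
    ext ω; simp [disjoint_union_right]
  rw [hi] at hu
  nlinarith

lemma indep_of (h : Base P Z) (R₀ : ℝ)
    (hindep : ∀ A B : Set UpperHalfPlane, (∀ a ∈ A, ∀ b ∈ B, R₀ ≤ dist a b) →
      Indep ((effrosSigma UpperHalfPlane).comap fun ω => Z ω ∩ A)
        ((effrosSigma UpperHalfPlane).comap fun ω => Z ω ∩ B) P)
    (A B T T') (hT : Ev A T) (hT' : Ev B T') (hd : ∀ a ∈ A, ∀ b ∈ B, R₀ ≤ dist a b) :
    P.real {ω | Z ω ∈ T ∩ T'} = P.real {ω | Z ω ∈ T} * P.real {ω | Z ω ∈ T'} := by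
  have hm : ∀ A T, Ev A T →
      MeasurableSet[(effrosSigma UpperHalfPlane).comap fun ω => Z ω ∩ A] {ω | Z ω ∈ T} := by
    rintro A T ⟨T1, h1, h2⟩
    have e : {ω | Z ω ∈ T} = Z ⁻¹' T1 := by ext ω; exact h2 _ (h.closed ω)
    rw [e]
    have : @Measurable _ _ ((effrosSigma UpperHalfPlane).comap fun ω => Z ω ∩ A) (avoidS A) Z := by
      refine @measurable_generateFrom _ _ (_) _ _ ?_
      rintro _ ⟨K, hK, hKA, rfl⟩
      refine ⟨_, (effros_meas hK).compl, ?_⟩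
      ext ω
      have : Z ω ∩ A ∩ K = Z ω ∩ K := by rw [inter_assoc, inter_eq_right.2 hKA]
      simp [this, disjoint_iff_inter_eq_empty, not_nonempty_iff_eq_empty]
    exact this h1
  have h1 := (Indep_iff _ _ P).1 (hindep A B hd) _ _ (hm A T hT) (hm B T' hT')
  have e : {ω | Z ω ∈ T ∩ T'} = {ω | Z ω ∈ T} ∩ {ω | Z ω ∈ T'} := rfl
  rw [e, measureReal_def, h1, ENNReal.toReal_mul]; rfl

lemma sepBound_of (ψ : UpperHalfPlane ≃ᵢ UpperHalfPlane) (s : Set UpperHalfPlane)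
    (hf : Finite (ConnectedComponents ↥(Metric.closedBall (ψ UpperHalfPlane.I) 1 \ s))) :
    SepBound (ψ ⁻¹' s)
      (Nat.card (ConnectedComponents ↥(Metric.closedBall (ψ UpperHalfPlane.I) 1 \ s)) : ℝ≥0∞) := by
  intro J hJ hsep
  have hmem : ∀ p ∈ J, ψ p ∈ Metric.closedBall (ψ UpperHalfPlane.I) 1 \ s := by
    intro p hp
    refine ⟨?_, (hJ p hp).2⟩
    have := (hJ p hp).1
    rw [Metric.mem_closedBall] at this ⊢
    rwa [ψ.dist_eq]
  let F : J → ConnectedComponents ↥(Metric.closedBall (ψ UpperHalfPlane.I) 1 \ s) :=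
    fun p => ConnectedComponents.mk ⟨ψ p.1, hmem p.1 p.2⟩
  have hF : Function.Injective F := by
    intro p q hpq
    by_contra hne
    refine hsep p.1 p.2 q.1 q.2 (fun hh => hne (Subtype.ext hh)) ?_
    have hc := ConnectedComponents.coe_eq_coe'.1 hpq
    refine ⟨(fun x => ψ.symm x.1) '' connectedComponent
      (⟨ψ q.1, hmem q.1 q.2⟩ : ↥(Metric.closedBall (ψ UpperHalfPlane.I) 1 \ s)), ?_, ?_, ?_, ?_⟩
    · exact isPreconnected_connectedComponent.image _
        (ψ.symm.continuous.comp continuous_subtype_val).continuousOn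
    · rintro _ ⟨x, -, rfl⟩
      refine ⟨?_, ?_⟩
      · have := x.2.1
        rw [Metric.mem_closedBall] at this ⊢
        rw [← ψ.dist_eq]; simpa using this
      · have := x.2.2
        simpa using this
    · exact ⟨_, hc, by simp⟩
    · exact ⟨_, mem_connectedComponent, by simp⟩
  have h1 := Nat.card_le_card_of_injective F hF
  rw [Nat.card_eq_fintype_card, Fintype.card_coe] at h1
  exact_mod_cast h1

end
end Vis

/-- for a well-behaved percolation `Z` in the hyperbolic plane
(isometry-invariant, FKG, independent at distance `R₀`, finite expected number of
vacant components and of boundary length in a unit disc, `P(B(1) ⊆ Z) > 0`) whose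
`α`-value satisfies `α ≥ 1`, almost surely no geodesic ray from a fixed point `o`
to the ideal boundary is contained in `Z`: the visibility set `𝔙` is a.s. empty. -/
theorem visibility_empty_of_alpha_ge_one
    [MeasurableSpace UpperHalfPlane] [BorelSpace UpperHalfPlane]
    {Ω : Type*} [MeasurableSpace Ω] (P : Measure Ω) [IsProbabilityMeasure P]
    (Z : Ω → Set UpperHalfPlane)
    (hZclosed : ∀ ω, IsClosed (Z ω))
    (hZmeas : @Measurable Ω (Set UpperHalfPlane) _ (effrosSigma UpperHalfPlane) Z)
    -- (i) isometry invariance of the law (via the capacity functional)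
    (hinv : ∀ (φ : UpperHalfPlane ≃ᵢ UpperHalfPlane) (K : Set UpperHalfPlane),
      IsCompact K → P {ω | (Z ω ∩ K).Nonempty} = P {ω | (Z ω ∩ φ '' K).Nonempty})
    -- (ii) FKG inequality for bounded increasing measurable functionals of Z
    (hFKG : ∀ g h : Set UpperHalfPlane → ℝ,
      Monotone g → Monotone h →
      @Measurable (Set UpperHalfPlane) ℝ (effrosSigma UpperHalfPlane) _ g →
      @Measurable (Set UpperHalfPlane) ℝ (effrosSigma UpperHalfPlane) _ h →
      (∃ M, ∀ s, |g s| ≤ M) → (∃ M, ∀ s, |h s| ≤ M) →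
      (∫ ω, g (Z ω) ∂P) * (∫ ω, h (Z ω) ∂P) ≤ ∫ ω, g (Z ω) * h (Z ω) ∂P)
    -- (iii) independence at distance R₀
    (R₀ : ℝ) (hR₀ : 0 < R₀)
    (hindep : ∀ A B : Set UpperHalfPlane, (∀ a ∈ A, ∀ b ∈ B, R₀ ≤ dist a b) →
      Indep ((effrosSigma UpperHalfPlane).comap fun ω => Z ω ∩ A)
        ((effrosSigma UpperHalfPlane).comap fun ω => Z ω ∩ B) P)
    (o : UpperHalfPlane)
    -- (iv) finite expected number of connected components of B(1) \ Z
    (hcomp : ∀ᵐ ω ∂P, Finite (ConnectedComponents ↥(Metric.closedBall o 1 \ Z ω)))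
    (hcompExp : ∫⁻ ω, (Nat.card (ConnectedComponents ↥(Metric.closedBall o 1 \ Z ω)) : ℝ≥0∞) ∂P < ∞)
    -- (v) finite expected boundary length in B(1)
    (hlen : ∫⁻ ω, μH[1] (Metric.closedBall o 1 ∩ frontier (Z ω)) ∂P < ∞)
    -- (vi) P(B(1) ⊆ Z) > 0
    (hfull : 0 < P {ω | Metric.closedBall o 1 ⊆ Z ω})
    -- f(r): probability that a fixed geodesic segment of length r lies in Z
    (γ : ℝ → UpperHalfPlane) (hγ : Isometry γ)
    (f : ℝ → ℝ) (hfdef : ∀ r > (0 : ℝ), f r = (P {ω | γ '' Icc 0 r ⊆ Z ω}).toReal)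
    -- the α-value: f(r) = Θ(e^{-α r}), here with α ≥ 1
    (α : ℝ) (hα : 1 ≤ α)
    (hαval : ∃ c₁ c₂ : ℝ, 0 < c₁ ∧ 0 < c₂ ∧ ∀ r : ℝ, 1 ≤ r →
      c₁ * Real.exp (-α * r) ≤ f r ∧ f r ≤ c₂ * Real.exp (-α * r))
    -- the family of all unit-speed geodesic rays from o, indexed by directions
    (ray : (Metric.sphere (0 : EuclideanSpace ℝ (Fin 2)) 1) → ℝ → UpperHalfPlane)
    (hray0 : ∀ θ, ray θ 0 = o)
    (hraygeo : ∀ θ, ∀ s t : ℝ, 0 ≤ s → 0 ≤ t → dist (ray θ s) (ray θ t) = |s - t|)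
    (hrayAll : ∀ g : ℝ → UpperHalfPlane, g 0 = o →
      (∀ s t : ℝ, 0 ≤ s → 0 ≤ t → dist (g s) (g t) = |s - t|) →
      ∃ θ, ∀ t : ℝ, 0 ≤ t → g t = ray θ t)
    -- the visibility set 𝔙 of directions in which a full ray lies in Z
    (𝔙 : Ω → Set (Metric.sphere (0 : EuclideanSpace ℝ (Fin 2)) 1))
    (h𝔙 : ∀ ω, 𝔙 ω = {θ | ∀ t : ℝ, 0 ≤ t → ray θ t ∈ Z ω}) :
    ∀ᵐ ω ∂P, 𝔙 ω = ∅ := by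
  obtain ⟨c₁, c₂, hc₁, hc₂, hval⟩ := hαval
  obtain ⟨ψ, rfl⟩ := Vis.exists_iso o
  have hB : Vis.Base P Z := Vis.base_of hZclosed hZmeas hinv
  have hB' := hB.pull ψ
  have hC : Vis.Core P (fun ω => ψ ⁻¹' Z ω) R₀ c₂ (fun ω =>
      (Nat.card (ConnectedComponents ↥(Metric.closedBall (ψ UpperHalfPlane.I) 1 \ Z ω)) : ℝ≥0∞)) := by
    refine { toBase := hB', fkg := ?_, R_pos := hR₀, indep := ?_, comp := ?_, exp := hcompExp,
             c_pos := hc₂, decay := ?_ }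
    · intro K K' hK hK'
      simp only [Vis.disjoint_preimage_iff, image_union]
      exact Vis.fkg_of hB hFKG _ _ (hK.image ψ.continuous) (hK'.image ψ.continuous)
    · intro A B T T' hT hT' hd
      refine Vis.indep_of hB R₀ hindep _ _ _ _ (hT.map ψ) (hT'.map ψ) ?_
      rintro _ ⟨a, ha, rfl⟩ _ ⟨b, hb, rfl⟩
      rw [ψ.dist_eq]; exact hd a ha b hb
    · filter_upwards [hcomp] with ω hω
      exact Vis.sepBound_of ψ (Z ω) hω
    · intro r hr
      obtain ⟨χ, hχ⟩ := Vis.exists_iso (γ 0)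
      obtain ⟨φ, -, -, hφ⟩ := Vis.ray_dir (fun t => χ.symm (γ t)) (by simp [← hχ])
        (fun s t _ _ => by rw [χ.symm.dist_eq, hγ.dist_eq, Real.dist_eq])
      have hφ' : ∀ t : ℝ, 0 ≤ t → γ t = χ (Vis.rot φ (Vis.axis t)) := by
        intro t ht
        rw [← hφ t ht]; simp
      have hev : Vis.Ev univ {s | Vis.axis '' Icc 0 r ⊆ s} := Vis.Ev.subset (subset_univ _)
      have l1 := hB.lawR ψ hev
      have l2 := hB.lawR ((Vis.rot φ).trans χ) hev
      have e : {ω | γ '' Icc 0 r ⊆ Z ω} =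
          {ω | ((Vis.rot φ).trans χ) ⁻¹' Z ω ∈ {s | Vis.axis '' Icc 0 r ⊆ s}} := by
        ext ω
        show γ '' Icc 0 r ⊆ Z ω ↔ Vis.axis '' Icc 0 r ⊆ ((Vis.rot φ).trans χ) ⁻¹' Z ω
        simp only [image_subset_iff]
        refine forall₂_congr fun t ht => ?_
        show γ t ∈ Z ω ↔ χ (Vis.rot φ (Vis.axis t)) ∈ Z ω
        rw [hφ' t ht.1]
      have h1 := (hval r hr).2
      rw [hfdef r (by linarith), e] at h1
      refine (l1.trans l2.symm).trans_le (le_trans h1 ?_)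
      gcongr
      nlinarith
  have h0 := hC.main
  rw [ae_iff]
  refine measure_mono_null ?_ h0
  intro ω hω
  obtain ⟨θ, hθ⟩ := nonempty_iff_ne_empty.2 hω
  rw [h𝔙] at hθ
  obtain ⟨φ, hφ1, hφ2, hφ⟩ := Vis.ray_dir (fun t => ψ.symm (ray θ t)) (by simp [hray0])
    (fun s t hs ht => by rw [ψ.symm.dist_eq, hraygeo θ s t hs ht])
  refine ⟨φ, hφ1, hφ2, fun t ht => ?_⟩
  rw [← hφ t ht]
  show ψ (ψ.symm (ray θ t)) ∈ Z ω
  rw [ψ.apply_symm_apply]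
  exact hθ t ht
end

section
/- Let η be a Poisson process in H² of intensity λ with i.i.d. random radii R attached to its points satisfying E[e^R] < ∞. Then the vacant phase V of the resulting Boolean model has α-value α = 2λ E[sinh R]; i.e., the probability that a geodesic segment of length r is contained in V is Θ(exp(−2λ E[sinh R] r)). -/
open MeasureTheory ENNReal Set

namespace VacantAux
open UpperHalfPlane Filter Topology

/-- Two-sided ball sandwich. -/
def BallSandwich (m : Measure ℍ) : Prop :=
  ∀ (x : ℍ) (s : ℝ), 0 < s →
    ENNReal.ofReal (Real.exp (-(2 * s)) * (Real.pi * Real.sinh s ^ 2)) ≤ m (Metric.closedBall x s) ∧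
    m (Metric.closedBall x s) ≤ ENNReal.ofReal (Real.exp (2 * s) * (Real.pi * Real.sinh s ^ 2))

lemma BallSandwich.locFin {m : Measure ℍ} (h : BallSandwich m) : IsLocallyFiniteMeasure m :=
  ⟨fun x => ⟨Metric.closedBall x 1, Metric.closedBall_mem_nhds x one_pos,
    (h x 1 one_pos).2.trans_lt ENNReal.ofReal_lt_top⟩⟩

lemma BallSandwich.doubling {m : Measure ℍ} (h : BallSandwich m) : IsUnifLocDoublingMeasure m := by
  refine ⟨⟨Real.toNNReal (Real.exp 6 * 4 * Real.cosh 1 ^ 2), ?_⟩⟩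
  filter_upwards [Ioc_mem_nhdsGT (zero_lt_one' ℝ)] with s hs x
  refine (h x (2 * s) (by linarith [hs.1])).2.trans ?_
  refine le_trans ?_ (mul_le_mul_right (h x s hs.1).1 _)
  rw [← ENNReal.ofReal, ← ENNReal.ofReal_mul (by positivity)]
  apply ENNReal.ofReal_le_ofReal
  rw [Real.sinh_two_mul]
  have h1 : Real.cosh s ≤ Real.cosh 1 := by
    rw [Real.cosh_le_cosh, abs_of_pos hs.1]; simpa using hs.2
  have h2 : Real.exp (2 * (2 * s)) ≤ Real.exp 6 * Real.exp (-(2 * s)) := by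
    rw [← Real.exp_add, Real.exp_le_exp]; linarith [hs.2]
  have h0 := (Real.cosh_pos s).le
  calc Real.exp (2 * (2 * s)) * (Real.pi * (2 * Real.sinh s * Real.cosh s) ^ 2)
      = Real.exp (2 * (2 * s)) * (4 * Real.pi * Real.sinh s ^ 2) * Real.cosh s ^ 2 := by ring
    _ ≤ (Real.exp 6 * Real.exp (-(2 * s))) * (4 * Real.pi * Real.sinh s ^ 2) * Real.cosh 1 ^ 2 := by
      gcongr
    _ = _ := by ring

lemma BallSandwich.le {m₁ m₂ : Measure ℍ} (h₁ : BallSandwich m₁) (h₂ : BallSandwich m₂) :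
    m₁ ≤ m₂ := by
  have := h₁.locFin
  have := h₂.locFin
  have := h₁.doubling
  refine Measure.le_iff.2 fun A _ => ?_
  have key : ∀ ε : NNReal, 1 < ε → m₁ A ≤ ε * m₂ A := by
    intro ε hε
    have : IsLocallyFiniteMeasure (ε • m₂) := by infer_instance
    have hle : m₁ A ≤ (ε • m₂) A := by
      refine (IsUnifLocDoublingMeasure.vitaliFamily m₁ 1).measure_le_of_frequently_le
        (ε • m₂) Measure.AbsolutelyContinuous.rfl A fun x _ => ?_
      have ht := IsUnifLocDoublingMeasure.tendsto_closedBall_filterAt m₁ (K := 1) (x := x)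
        (l := 𝓝[>] (0 : ℝ)) (fun _ => x) (fun s => s) tendsto_id (by
          filter_upwards [self_mem_nhdsWithin] with s hs
          simpa using (le_of_lt hs))
      refine ht.frequently (Eventually.frequently ?_)
      have hc : Tendsto (fun s : ℝ => Real.exp (4 * s)) (𝓝[>] 0) (𝓝 1) := by
        have : Continuous (fun s : ℝ => Real.exp (4 * s)) := by fun_prop
        simpa using (this.tendsto 0).mono_left nhdsWithin_le_nhds
      have hε' : (1 : ℝ) < ε := by exact_mod_cast hε
      filter_upwards [self_mem_nhdsWithin, hc.eventually (gt_mem_nhds hε')] with s hs hs2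
      refine (h₁ x s hs).2.trans ?_
      rw [Measure.smul_apply, ENNReal.smul_def, smul_eq_mul]
      refine le_trans ?_ (mul_le_mul_right (h₂ x s hs).1 _)
      rw [← ENNReal.ofReal_coe_nnreal, ← ENNReal.ofReal_mul (by positivity)]
      apply ENNReal.ofReal_le_ofReal
      rw [← mul_assoc (ε : ℝ)]
      refine mul_le_mul_of_nonneg_right ?_ (by positivity)
      have : Real.exp (2 * s) = Real.exp (4 * s) * Real.exp (-(2 * s)) := by
        rw [← Real.exp_add]; ring_nf
      rw [this]
      exact mul_le_mul_of_nonneg_right hs2.le (Real.exp_pos _).le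
    exact hle
  by_cases hA : m₂ A = ∞
  · simp [hA]
  have ht : Tendsto (fun ε : NNReal => (ε : ℝ≥0∞) * m₂ A) (𝓝[>] 1) (𝓝 (1 * m₂ A)) := by
    refine ENNReal.Tendsto.mul_const ?_ (Or.inr hA)
    exact (ENNReal.tendsto_coe.2 tendsto_id).mono_left nhdsWithin_le_nhds
  rw [one_mul] at ht
  refine ge_of_tendsto ht ?_
  filter_upwards [self_mem_nhdsWithin] with ε hε using key ε hε

lemma sandwich_volume : BallSandwich (volume : Measure ℍ) := by
  intro x s hs
  rw [volume_eq_lintegral, image_coe_closedBall]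
  have hy := x.im_pos
  have him : ∀ z ∈ Metric.closedBall (x.center s : ℂ) (x.im * Real.sinh s),
      x.im * Real.exp (-s) ≤ z.im ∧ z.im ≤ x.im * Real.exp s := by
    intro z hz
    have h1 : |(z - (x.center s : ℂ)).im| ≤ x.im * Real.sinh s :=
      (Complex.abs_im_le_norm _).trans (by simpa [dist_eq_norm] using hz)
    rw [Complex.sub_im, UpperHalfPlane.coe_im, center_im, abs_le] at h1
    rw [← Real.cosh_sub_sinh, ← Real.cosh_add_sinh]
    constructor <;> nlinarith [h1.1, h1.2]
  have hvol : volume (Metric.closedBall (x.center s : ℂ) (x.im * Real.sinh s)) =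
      ENNReal.ofReal ((x.im * Real.sinh s) ^ 2 * Real.pi) := by
    have hsh := Real.sinh_pos_iff.2 hs
    rw [Complex.volume_closedBall, ENNReal.ofReal_mul (p := (x.im * Real.sinh s) ^ 2) (by positivity),
      ENNReal.ofReal_pow (by positivity)]
    congr 1
    exact (ENNReal.ofReal_coe_nnreal (p := NNReal.pi)).symm
  have hint : ∀ z : ℂ, 0 < z.im →
      (((1 / ‖z.im‖₊) ^ 2 : NNReal) : ℝ≥0∞) = ENNReal.ofReal (1 / z.im ^ 2) := by
    intro z hz
    rw [← ENNReal.ofReal_coe_nnreal]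
    congr 1
    simp
  constructor
  · calc _ = ∫⁻ z in Metric.closedBall (x.center s : ℂ) (x.im * Real.sinh s),
          ENNReal.ofReal (1 / (x.im * Real.exp s) ^ 2) := by
          rw [setLIntegral_const, hvol, ← ENNReal.ofReal_mul (by positivity)]
          congr 1
          have : Real.exp (-(2 * s)) = 1 / (Real.exp s) ^ 2 := by
            rw [Real.exp_neg, ← Real.exp_nat_mul]; simp
          rw [this]; field_simp
      _ ≤ _ := by
          refine setLIntegral_mono' Metric.isClosed_closedBall.measurableSet fun z hz => ?_
          have h1 := him z hz
          have : 0 < z.im := lt_of_lt_of_le (by positivity) h1.1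
          rw [hint z this]
          apply ENNReal.ofReal_le_ofReal
          gcongr
          exact h1.2
  · calc _ ≤ ∫⁻ z in Metric.closedBall (x.center s : ℂ) (x.im * Real.sinh s),
          ENNReal.ofReal (1 / (x.im * Real.exp (-s)) ^ 2) := by
          refine setLIntegral_mono' Metric.isClosed_closedBall.measurableSet fun z hz => ?_
          have h1 := him z hz
          have : 0 < z.im := lt_of_lt_of_le (by positivity) h1.1
          rw [hint z this]
          apply ENNReal.ofReal_le_ofReal
          gcongr
          exact h1.1
      _ = _ := by
          rw [setLIntegral_const, hvol, ← ENNReal.ofReal_mul (by positivity)]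
          congr 1
          have : Real.exp (2 * s) = 1 / (Real.exp (-s)) ^ 2 := by
            rw [Real.exp_neg, inv_pow, ← Real.exp_nat_mul]; simp
          rw [this]; field_simp

lemma sandwich_of_ball {μ : Measure ℍ} (hμball : ∀ (x : ℍ) (s : ℝ), 0 ≤ s →
      μ (Metric.closedBall x s) = ENNReal.ofReal (2 * Real.pi * (Real.cosh s - 1))) :
    BallSandwich μ := by
  intro x s hs
  rw [hμball x s hs.le]
  have hc := Real.one_le_cosh s
  have hsq : Real.sinh s ^ 2 = (Real.cosh s - 1) * (Real.cosh s + 1) := by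
    rw [Real.sinh_sq]; ring
  have hce : Real.cosh s ≤ Real.exp s := by
    rw [← Real.cosh_add_sinh]; linarith [Real.sinh_pos_iff.2 hs]
  have he1 : 1 ≤ Real.exp s := Real.one_le_exp hs.le
  have he2 : Real.exp (2 * s) = Real.exp s * Real.exp s := by rw [← Real.exp_add]; ring_nf
  have hp := Real.pi_pos
  constructor <;> apply ENNReal.ofReal_le_ofReal
  · rw [hsq, Real.exp_neg, inv_mul_le_iff₀ (Real.exp_pos _), he2]
    have : Real.cosh s + 1 ≤ 2 * (Real.exp s * Real.exp s) := by nlinarith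
    have h0 : 0 ≤ Real.pi * (Real.cosh s - 1) := mul_nonneg hp.le (by linarith)
    nlinarith
  · rw [hsq]
    have h0 : 0 ≤ Real.pi * (Real.cosh s - 1) := mul_nonneg hp.le (by linarith)
    have h1 : 1 ≤ Real.exp (2 * s) := Real.one_le_exp (by linarith)
    have h2 : 2 ≤ Real.exp (2 * s) * (Real.cosh s + 1) := by nlinarith
    nlinarith

lemma eq_volume {μ : Measure ℍ} (hμball : ∀ (x : ℍ) (s : ℝ), 0 ≤ s →
      μ (Metric.closedBall x s) = ENNReal.ofReal (2 * Real.pi * (Real.cosh s - 1))) :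
    μ = volume :=
  le_antisymm ((sandwich_of_ball hμball).le sandwich_volume)
    (sandwich_volume.le (sandwich_of_ball hμball))

lemma lintegral_one_div {a r : ℝ} (ha : 0 < a) (hr : 0 ≤ r) :
    ∫⁻ y in Icc a (a * Real.exp r), ENNReal.ofReal (1 / y) = ENNReal.ofReal r := by
  have hle : a ≤ a * Real.exp r := le_mul_of_one_le_right ha.le (Real.one_le_exp hr)
  have hcont : ContinuousOn (fun y : ℝ => 1 / y) (Icc a (a * Real.exp r)) :=
    continuousOn_const.div continuousOn_id fun y hy => (ha.trans_le hy.1).ne'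
  rw [← ofReal_integral_eq_lintegral_ofReal hcont.integrableOn_Icc]
  · rw [integral_Icc_eq_integral_Ioc, ← intervalIntegral.integral_of_le hle,
      integral_one_div_of_pos ha (by positivity)]
    congr 1
    rw [mul_div_cancel_left₀ _ ha.ne', Real.log_exp]
  · filter_upwards [self_mem_ae_restrict measurableSet_Icc] with y hy
    have := ha.trans_le hy.1
    simp only [Pi.zero_apply]; positivity

/-- The strip. -/
def strip (E : Set ℝ) (r : ℝ) : Set ℍ :=
  {z : ℍ | z.re / z.im ∈ E ∧ 1 ≤ z.re ^ 2 + z.im ^ 2 ∧ z.re ^ 2 + z.im ^ 2 ≤ Real.exp r ^ 2}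

/-- integrand -/
noncomputable def G (E : Set ℝ) (r : ℝ) (x y : ℝ) : ℝ≥0∞ :=
  {p : ℝ × ℝ | 0 < p.2 ∧ p.1 / p.2 ∈ E ∧ 1 ≤ p.1 ^ 2 + p.2 ^ 2 ∧
    p.1 ^ 2 + p.2 ^ 2 ≤ Real.exp r ^ 2}.indicator (fun p => ENNReal.ofReal (1 / p.2 ^ 2)) (x, y)

lemma measurableSet_G {E : Set ℝ} (hE : MeasurableSet E) (r : ℝ) :
    MeasurableSet {p : ℝ × ℝ | 0 < p.2 ∧ p.1 / p.2 ∈ E ∧ 1 ≤ p.1 ^ 2 + p.2 ^ 2 ∧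
    p.1 ^ 2 + p.2 ^ 2 ≤ Real.exp r ^ 2} := by
  refine (measurableSet_lt measurable_const measurable_snd).inter ?_
  refine ((measurable_fst.div measurable_snd) hE).inter ?_
  have hq : Measurable fun p : ℝ × ℝ => p.1 ^ 2 + p.2 ^ 2 := by fun_prop
  exact (measurableSet_le measurable_const hq).inter (measurableSet_le hq measurable_const)

lemma measurable_G {E : Set ℝ} (hE : MeasurableSet E) (r : ℝ) :
    Measurable (fun p : ℝ × ℝ => G E r p.1 p.2) := by
  unfold G
  refine Measurable.indicator ?_ (measurableSet_G hE r)
  fun_prop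

lemma G_scale (E : Set ℝ) {r y : ℝ} (k : ℝ) (hy : 0 < y) :
    ENNReal.ofReal y * G E r (k * y) y = E.indicator 1 k *
      (Icc (√(1 + k ^ 2))⁻¹ ((√(1 + k ^ 2))⁻¹ * Real.exp r)).indicator
        (fun y => ENNReal.ofReal (1 / y)) y := by
  have hc : 0 < √(1 + k ^ 2) := Real.sqrt_pos.2 (by positivity)
  have hsq : (k * y) ^ 2 + y ^ 2 = (√(1 + k ^ 2) * y) ^ 2 := by
    rw [mul_pow (√(1 + k ^ 2)), Real.sq_sqrt (by positivity)]; ring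
  have h1 : (1 ≤ (k * y) ^ 2 + y ^ 2 ∧ (k * y) ^ 2 + y ^ 2 ≤ Real.exp r ^ 2) ↔
      y ∈ Icc (√(1 + k ^ 2))⁻¹ ((√(1 + k ^ 2))⁻¹ * Real.exp r) := by
    rw [hsq, mem_Icc, one_le_sq_iff₀ (by positivity),
      sq_le_sq₀ (by positivity) (by positivity), inv_le_iff_one_le_mul₀' hc, le_inv_mul_iff₀ hc]
  unfold G
  by_cases hk : k ∈ E
  · by_cases hy2 : y ∈ Icc (√(1 + k ^ 2))⁻¹ ((√(1 + k ^ 2))⁻¹ * Real.exp r)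
    · rw [indicator_of_mem, indicator_of_mem hk, indicator_of_mem hy2,
        ← ENNReal.ofReal_mul hy.le]
      · simp only [Pi.one_apply, one_mul]
        congr 1; field_simp
      · refine ⟨hy, ?_, h1.2 hy2⟩
        simpa [hy.ne'] using hk
    · rw [indicator_of_notMem, indicator_of_notMem hy2]
      · simp
      · rintro ⟨-, -, h⟩
        exact hy2 (h1.1 h)
  · rw [indicator_of_notMem, indicator_of_notMem hk]
    · simp
    · rintro ⟨-, h, -⟩
      simp [hy.ne'] at h
      exact hk h

lemma lintegral_G {E : Set ℝ} (hE : MeasurableSet E) {r : ℝ} (hr : 0 ≤ r) :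
    ∫⁻ y, ∫⁻ x, G E r x y = ENNReal.ofReal r * volume E := by
  have hm := measurable_G hE r
  have h1 : ∀ y : ℝ, ∫⁻ x, G E r x y = ∫⁻ k, E.indicator 1 k *
      (Icc (√(1 + k ^ 2))⁻¹ ((√(1 + k ^ 2))⁻¹ * Real.exp r)).indicator
        (fun y => ENNReal.ofReal (1 / y)) y := by
    intro y
    rcases lt_or_ge 0 y with hy | hy
    · have hmy : Measurable (fun x => G E r x y) := hm.comp (by fun_prop : Measurable fun x : ℝ => (x, y))
      conv_lhs => rw [← Real.smul_map_volume_mul_right hy.ne']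
      rw [lintegral_smul_measure, lintegral_map hmy (by fun_prop), abs_of_pos hy, smul_eq_mul,
        ← lintegral_const_mul (f := fun x => G E r (x * y) y) _ (hmy.comp (by fun_prop : Measurable fun x : ℝ => x * y))]
      exact lintegral_congr fun k => G_scale E k hy
    · have e1 : ∀ x, G E r x y = 0 := fun x => by
        unfold G
        rw [indicator_of_notMem]
        exact fun h => absurd h.1 (not_lt.2 hy)
      have e2 : ∀ k : ℝ, y ∉ (Icc (√(1 + k ^ 2))⁻¹ ((√(1 + k ^ 2))⁻¹ * Real.exp r)) := by
        intro k h
        have hc : 0 < (√(1 + k ^ 2))⁻¹ := inv_pos.2 (Real.sqrt_pos.2 (by positivity))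
        linarith [h.1]
      simp [e1, e2]
  simp_rw [h1]
  rw [lintegral_lintegral_swap]
  · have h2 : ∀ k : ℝ, ∫⁻ y, E.indicator 1 k *
      (Icc (√(1 + k ^ 2))⁻¹ ((√(1 + k ^ 2))⁻¹ * Real.exp r)).indicator
        (fun y => ENNReal.ofReal (1 / y)) y = E.indicator (fun _ => ENNReal.ofReal r) k := by
      intro k
      have hc : 0 < (√(1 + k ^ 2))⁻¹ := inv_pos.2 (Real.sqrt_pos.2 (by positivity))
      rw [lintegral_const_mul _ ((by fun_prop : Measurable fun y : ℝ => ENNReal.ofReal (1 / y)).indicator measurableSet_Icc),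
        lintegral_indicator measurableSet_Icc, lintegral_one_div hc hr]
      by_cases hk : k ∈ E <;> simp [hk]
    simp_rw [h2]
    rw [lintegral_indicator hE, setLIntegral_const]
  · refine Measurable.aemeasurable ?_
    refine Measurable.mul ?_ ?_
    · exact (measurable_one.indicator hE).comp measurable_snd
    · have h3 : Measurable ({p : ℝ × ℝ | (√(1 + p.2 ^ 2))⁻¹ ≤ p.1 ∧
          p.1 ≤ (√(1 + p.2 ^ 2))⁻¹ * Real.exp r}.indicator
            (fun p => ENNReal.ofReal (1 / p.1))) := by
        refine Measurable.indicator (by fun_prop) ?_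
        have hq : Measurable fun p : ℝ × ℝ => (√(1 + p.2 ^ 2))⁻¹ := by fun_prop
        exact (measurableSet_le hq measurable_fst).inter
          (measurableSet_le measurable_fst (hq.mul_const _))
      exact h3

lemma volume_strip {E : Set ℝ} (hE : MeasurableSet E) {r : ℝ} (hr : 0 ≤ r) :
    volume (strip E r) = ENNReal.ofReal r * volume E := by
  rw [← lintegral_G hE hr, volume_eq_lintegral]
  have hm := measurable_G hE r
  have himg : ((↑) : ℍ → ℂ) '' strip E r = Complex.measurableEquivRealProd ⁻¹'
      {p : ℝ × ℝ | 0 < p.2 ∧ p.1 / p.2 ∈ E ∧ 1 ≤ p.1 ^ 2 + p.2 ^ 2 ∧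
        p.1 ^ 2 + p.2 ^ 2 ≤ Real.exp r ^ 2} := by
    ext z
    constructor
    · rintro ⟨w, hw, rfl⟩
      exact ⟨w.im_pos, hw⟩
    · rintro ⟨h1, h2⟩
      exact ⟨⟨z, h1⟩, h2, rfl⟩
  have hms := Complex.measurableEquivRealProd.measurable (measurableSet_G hE r)
  rw [himg, ← lintegral_indicator hms]
  have : ∀ z : ℂ, (Complex.measurableEquivRealProd ⁻¹'
      {p : ℝ × ℝ | 0 < p.2 ∧ p.1 / p.2 ∈ E ∧ 1 ≤ p.1 ^ 2 + p.2 ^ 2 ∧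
        p.1 ^ 2 + p.2 ^ 2 ≤ Real.exp r ^ 2}).indicator
        (fun z : ℂ => (((1 / ‖z.im‖₊) ^ 2 : NNReal) : ℝ≥0∞)) z =
        (fun p : ℝ × ℝ => G E r p.1 p.2) (Complex.measurableEquivRealProd z) := by
    intro z
    by_cases hz : Complex.measurableEquivRealProd z ∈ {p : ℝ × ℝ | 0 < p.2 ∧ p.1 / p.2 ∈ E ∧ 1 ≤ p.1 ^ 2 + p.2 ^ 2 ∧
        p.1 ^ 2 + p.2 ^ 2 ≤ Real.exp r ^ 2}
    · rw [indicator_of_mem (mem_preimage.2 hz)]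
      simp only [G]
      rw [indicator_of_mem hz, ← ENNReal.ofReal_coe_nnreal]
      congr 1
      simp
    · rw [indicator_of_notMem (fun h => hz (mem_preimage.1 h))]
      simp only [G]
      rw [indicator_of_notMem hz]
  simp_rw [this]
  rw [Complex.volume_preserving_equiv_real_prod.lintegral_comp hm]
  exact lintegral_prod_symm _ hm.aemeasurable
/-- The standard vertical geodesic. -/
noncomputable def ell (t : ℝ) : ℍ := ⟨⟨0, Real.exp t⟩, Real.exp_pos t⟩

@[simp] lemma ell_re (t : ℝ) : (ell t).re = 0 := rfl
@[simp] lemma ell_im (t : ℝ) : (ell t).im = Real.exp t := rfl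

lemma cosh_dist_ell (z : ℍ) (t : ℝ) : Real.cosh (dist z (ell t)) =
    (z.re ^ 2 + z.im ^ 2 + Real.exp t ^ 2) / (2 * z.im * Real.exp t) := by
  rw [cosh_dist']; simp

lemma dist_le_of_cosh {z w : ℍ} {s : ℝ} (hs : 0 ≤ s) (h : Real.cosh (dist z w) ≤ Real.cosh s) :
    dist z w ≤ s := by
  rwa [Real.cosh_le_cosh, abs_of_nonneg dist_nonneg, abs_of_nonneg hs] at h

lemma tube_upper {z : ℍ} {s t r : ℝ} (hs : 0 ≤ s) (ht0 : 0 ≤ t) (htr : t ≤ r)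
    (h : dist z (ell t) ≤ s) :
    z ∈ strip (Icc (-Real.sinh s) (Real.sinh s)) r ∪
      (Metric.closedBall (ell 0) s ∪ Metric.closedBall (ell r) s) := by
  have hy := z.im_pos
  have hc : (z.re ^ 2 + z.im ^ 2 + Real.exp t ^ 2) / (2 * z.im * Real.exp t) ≤ Real.cosh s := by
    rw [← cosh_dist_ell, Real.cosh_le_cosh, abs_of_nonneg dist_nonneg, abs_of_nonneg hs]
    exact h
  have ha : 1 ≤ Real.exp t := Real.one_le_exp ht0
  have hab : Real.exp t ≤ Real.exp r := Real.exp_le_exp.2 htr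
  set q := z.re ^ 2 + z.im ^ 2 with hq
  set a := Real.exp t
  set b := Real.exp r with hb
  have ha0 : 0 < a := by linarith
  have hb0 : 0 < b := by linarith
  by_cases h1 : 1 ≤ q
  · by_cases h2 : q ≤ b ^ 2
    · left
      refine ⟨?_, h1, h2⟩
      have h3 : q / z.im ^ 2 ≤ Real.cosh s ^ 2 := by
        refine le_trans ?_ (pow_le_pow_left₀ (by positivity) hc 2)
        rw [div_pow, div_le_div_iff₀ (by positivity) (by positivity)]
        have : 4 * a ^ 2 * q ≤ (q + a ^ 2) ^ 2 := by nlinarith [sq_nonneg (q - a ^ 2)]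
        nlinarith [mul_le_mul_of_nonneg_left this (sq_nonneg z.im)]
      have h4 : (z.re / z.im) ^ 2 ≤ Real.sinh s ^ 2 := by
        rw [Real.sinh_sq]
        have : q / z.im ^ 2 = (z.re / z.im) ^ 2 + 1 := by rw [hq]; field_simp
        linarith
      exact abs_le.1 (abs_le_of_sq_le_sq h4 (Real.sinh_nonneg_iff.2 hs))
    · right; right
      refine dist_le_of_cosh hs (le_trans ?_ hc)
      rw [cosh_dist_ell, ← hq, ← hb, div_le_div_iff₀ (by positivity) (by positivity)]
      have : 0 ≤ (b - a) * (q - a * b) := mul_nonneg (by linarith) (by nlinarith)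
      nlinarith [mul_nonneg hy.le this]
  · right; left
    refine dist_le_of_cosh hs (le_trans ?_ hc)
    rw [cosh_dist_ell, ← hq, Real.exp_zero, div_le_div_iff₀ (by positivity) (by positivity)]
    have : 0 ≤ (a - 1) * (a - q) := mul_nonneg (by linarith) (by linarith)
    nlinarith [mul_nonneg hy.le this]

lemma tube_lower {z : ℍ} {s r : ℝ} (hs : 0 ≤ s)
    (h : z ∈ strip (Ioo (-Real.sinh s) (Real.sinh s)) r) :
    ∃ t ∈ Icc 0 r, dist z (ell t) < s := by
  obtain ⟨h1, h2, h3⟩ := h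
  have hy := z.im_pos
  set q := z.re ^ 2 + z.im ^ 2 with hq
  have hq0 : 0 < √q := Real.sqrt_pos.2 (by linarith)
  have hsq : √q ^ 2 = q := Real.sq_sqrt (by linarith)
  refine ⟨Real.log (√q), ⟨Real.log_nonneg ?_, ?_⟩, ?_⟩
  · rwa [Real.one_le_sqrt]
  · rw [Real.log_le_iff_le_exp hq0]
    exact Real.sqrt_le_iff.2 ⟨(Real.exp_pos r).le, h3⟩
  · have : Real.cosh (dist z (ell (Real.log √q))) < Real.cosh s := by
      rw [cosh_dist_ell, ← hq, Real.exp_log hq0, hsq]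
      refine lt_of_pow_lt_pow_left₀ 2 (Real.cosh_pos s).le ?_
      have h4 : (z.re / z.im) ^ 2 < Real.sinh s ^ 2 :=
        sq_lt_sq.2 ((abs_lt.2 h1).trans_le (le_abs_self _))
      rw [Real.cosh_sq]
      have : ((q + q) / (2 * z.im * √q)) ^ 2 = (z.re / z.im) ^ 2 + 1 := by
        rw [div_pow, mul_pow, hsq]
        have : q ≠ 0 := by linarith
        field_simp
        rw [hq]; ring
      linarith
    rwa [Real.cosh_lt_cosh, abs_of_nonneg dist_nonneg, abs_of_nonneg hs] at this

lemma geodesic_unique {δ : ℝ → ℍ} (hδ : Isometry δ) (h0 : δ 0 = ell 0) (h1 : δ 1 = ell 1) (t : ℝ) :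
    δ t = ell t := by
  have e0 : Real.cosh (dist (δ t) (ell 0)) = Real.cosh t := by
    rw [← h0, hδ.dist_eq, Real.dist_eq, sub_zero, Real.cosh_abs]
  have e1 : Real.cosh (dist (δ t) (ell 1)) = Real.cosh (t - 1) := by
    rw [← h1, hδ.dist_eq, Real.dist_eq, Real.cosh_abs]
  rw [cosh_dist_ell] at e0 e1
  have hy := (δ t).im_pos
  set z := δ t
  set q := z.re ^ 2 + z.im ^ 2 with hq
  have hE := Real.exp_pos t
  have he := Real.exp_pos 1
  have he1 : 1 < Real.exp 1 := by simp
  rw [Real.cosh_eq, Real.exp_zero, div_eq_div_iff (by positivity) (by positivity), Real.exp_neg] at e0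
  rw [Real.cosh_eq, div_eq_div_iff (by positivity) (by positivity), neg_sub, Real.exp_sub,
    Real.exp_sub] at e1
  have hz : z.im = Real.exp t := by
    field_simp at e0 e1
    have : (z.im - Real.exp t) * (Real.exp 1 ^ 2 - 1) = 0 := by nlinarith
    rcases mul_eq_zero.1 this with h | h
    · linarith
    · nlinarith
  have hz2 : z.re = 0 := by
    rw [hz] at e0 hq
    field_simp at e0
    have : z.re ^ 2 = 0 := by nlinarith
    simpa using this
  apply UpperHalfPlane.ext
  exact Complex.ext hz2 hz

/-- Rotation about `i`. -/
noncomputable def rot (θ : ℝ) : Matrix.SpecialLinearGroup (Fin 2) ℝ :=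
  ⟨!![Real.cos θ, Real.sin θ; -Real.sin θ, Real.cos θ], by
    rw [Matrix.det_fin_two_of]; nlinarith [Real.sin_sq_add_cos_sq θ]⟩

lemma coe_rot_smul (θ : ℝ) (z : ℍ) : ((rot θ • z : ℍ) : ℂ) =
    ((Real.cos θ : ℂ) * z + (Real.sin θ : ℂ)) / (-(Real.sin θ : ℂ) * z + (Real.cos θ : ℂ)) := by
  rw [coe_specialLinearGroup_apply]
  simp [rot]

lemma rot_den (θ : ℝ) (z : ℍ) : (-(Real.sin θ : ℂ) * z + (Real.cos θ : ℂ)) ≠ 0 := by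
  intro h
  have h1 := congrArg Complex.im h
  have h2 := congrArg Complex.re h
  simp only [Complex.add_im, Complex.mul_im, Complex.neg_re, Complex.ofReal_re, Complex.neg_im,
    Complex.ofReal_im, Complex.add_re, Complex.mul_re, Complex.zero_im, Complex.zero_re,
    UpperHalfPlane.coe_im, UpperHalfPlane.coe_re] at h1 h2
  have h3 : Real.sin θ * z.im = 0 := by linarith
  have h4 : Real.sin θ = 0 := (mul_eq_zero.1 h3).resolve_right z.im_pos.ne'
  have h5 : Real.cos θ = 0 := by rw [h4] at h2; linarith
  have := Real.sin_sq_add_cos_sq θ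
  rw [h4, h5] at this
  norm_num at this

lemma coe_ell_zero : ((ell 0 : ℍ) : ℂ) = Complex.I := by
  apply Complex.ext <;> simp [ell]

lemma rot_smul_ell (θ : ℝ) : rot θ • ell 0 = ell 0 := by
  apply UpperHalfPlane.ext
  have := rot_den θ (ell 0)
  rw [coe_rot_smul, div_eq_iff this, coe_ell_zero]
  ring_nf
  rw [Complex.I_sq]; ring

lemma exists_rot_re (w : ℍ) : ∃ θ, (rot θ • w).re = 0 := by
  let N : ℝ → ℝ := fun θ => (Real.cos θ * w.re + Real.sin θ) * (-Real.sin θ * w.re + Real.cos θ)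
    - Real.cos θ * w.im * (Real.sin θ * w.im)
  have hN : Continuous N := by fun_prop
  have h0 : N 0 = w.re := by simp [N]
  have h1 : N (Real.pi / 2) = - w.re := by simp [N]
  have : ∃ θ, N θ = 0 := by
    have hc : IsPreconnected (Set.univ : Set ℝ) := isPreconnected_univ
    rcases le_total w.re 0 with h | h
    · obtain ⟨θ, -, h⟩ := hc.intermediate_value (mem_univ 0) (mem_univ (Real.pi / 2))
        hN.continuousOn (show (0 : ℝ) ∈ Icc _ _ from ⟨by linarith, by linarith⟩)
      exact ⟨θ, h⟩
    · obtain ⟨θ, -, h⟩ := hc.intermediate_value (mem_univ (Real.pi / 2)) (mem_univ 0)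
        hN.continuousOn (show (0 : ℝ) ∈ Icc _ _ from ⟨by linarith, by linarith⟩)
      exact ⟨θ, h⟩
  obtain ⟨θ, hθ⟩ := this
  refine ⟨θ, ?_⟩
  rw [← UpperHalfPlane.coe_re, coe_rot_smul, Complex.div_re, ← add_div]
  simp only [Complex.add_im, Complex.mul_im, Complex.neg_re, Complex.ofReal_re, Complex.neg_im,
    Complex.ofReal_im, Complex.add_re, Complex.mul_re,
    UpperHalfPlane.coe_im, UpperHalfPlane.coe_re]
  refine div_eq_zero_iff.2 (Or.inl ?_)
  refine Eq.trans ?_ hθ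
  simp only [N]; ring

lemma eq_ell_of_re {w : ℍ} (hre : w.re = 0) (hd : dist (ell 0) w = 1) : w = ell 1 ∨ w = ell (-1) := by
  rw [dist_of_re_eq (by simp [hre])] at hd
  simp only [ell_im, Real.exp_zero, Real.log_one, Real.dist_eq, zero_sub, abs_neg] at hd
  have : ∀ t, Real.log w.im = t → w = ell t := by
    rintro t rfl
    apply UpperHalfPlane.ext
    apply Complex.ext
    · exact hre
    · exact (Real.exp_log w.im_pos).symm
  rcases eq_or_eq_neg_of_abs_eq hd with h | h
  · exact Or.inl (this _ h)
  · exact Or.inr (this _ h)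

lemma rot_half_ell : rot (Real.pi / 2) • ell (-1) = ell 1 := by
  apply UpperHalfPlane.ext
  rw [coe_rot_smul]
  have e : ∀ t, ((ell t : ℍ) : ℂ) = (Real.exp t : ℂ) * Complex.I := fun t => by
    apply Complex.ext <;> simp [ell, -Complex.ofReal_exp]
  rw [e, e]
  simp only [Real.cos_pi_div_two, Real.sin_pi_div_two, Real.exp_neg]
  have : (Real.exp 1 : ℂ) ≠ 0 := by exact_mod_cast (Real.exp_pos 1).ne'
  push_cast at this ⊢
  field_simp
  rw [mul_assoc]
  simp

lemma exists_SL_normalize {γ : ℝ → ℍ} (hγ : Isometry γ) :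
    ∃ g : Matrix.SpecialLinearGroup (Fin 2) ℝ, ∀ t, g • γ t = ell t := by
  obtain ⟨g₁, h₁⟩ := MulAction.exists_smul_eq (Matrix.SpecialLinearGroup (Fin 2) ℝ) (γ 0) (ell 0)
  obtain ⟨θ, hθ⟩ := exists_rot_re (g₁ • γ 1)
  have hd : dist (ell 0) (rot θ • g₁ • γ 1) = 1 := by
    conv_lhs => rw [← rot_smul_ell θ, ← h₁]
    rw [dist_smul, dist_smul, hγ.dist_eq]; simp
  have fin : ∀ g : Matrix.SpecialLinearGroup (Fin 2) ℝ, g • γ 0 = ell 0 → g • γ 1 = ell 1 →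
      ∀ t, g • γ t = ell t := fun g a b t =>
    geodesic_unique (δ := fun t => g • γ t) ((isometry_smul ℍ g).comp hγ) a b t
  rcases eq_ell_of_re hθ hd with h | h
  · refine ⟨rot θ * g₁, fin _ ?_ ?_⟩
    · rw [mul_smul, h₁, rot_smul_ell]
    · rw [mul_smul, h]
  · refine ⟨rot (Real.pi / 2) * (rot θ * g₁), fin _ ?_ ?_⟩
    · rw [mul_smul, mul_smul, h₁, rot_smul_ell, rot_smul_ell]
    · rw [mul_smul, mul_smul, h, rot_half_ell]

lemma slice_upper {γ : ℝ → ℍ} (hγ : Isometry γ) {r s : ℝ} (hr : 0 ≤ r) (hs : 0 ≤ s)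
    (hball : ∀ (x : ℍ) (s : ℝ), 0 ≤ s →
      volume (Metric.closedBall x s) = ENNReal.ofReal (2 * Real.pi * (Real.cosh s - 1))) :
    volume {z : ℍ | Metric.infDist z (γ '' Icc 0 r) ≤ s} ≤
      ENNReal.ofReal (2 * r * Real.sinh s + 4 * Real.pi * (Real.cosh s - 1)) := by
  obtain ⟨g, hg⟩ := exists_SL_normalize hγ
  have hK : IsCompact (γ '' Icc 0 r) := isCompact_Icc.image hγ.continuous
  have hne : (γ '' Icc 0 r).Nonempty := (nonempty_Icc.2 hr).image _
  have hsub : {z : ℍ | Metric.infDist z (γ '' Icc 0 r) ≤ s} ⊆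
      (fun z => (g : GL (Fin 2) ℝ) • z) ⁻¹' (strip (Icc (-Real.sinh s) (Real.sinh s)) r ∪
      (Metric.closedBall (ell 0) s ∪ Metric.closedBall (ell r) s)) := by
    intro z hz
    obtain ⟨_, ⟨t, ht, rfl⟩, hd⟩ := hK.exists_infDist_eq_dist hne z
    rw [mem_ofPred_eq, hd] at hz
    refine tube_upper (z := g • z) hs ht.1 ht.2 ?_
    rwa [← hg, dist_smul]
  refine (measure_mono hsub).trans ?_
  rw [measure_preimage_smul]
  refine (measure_union_le _ _).trans ((add_le_add_right (measure_union_le _ _) _).trans ?_)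
  have hsh := Real.sinh_nonneg_iff.2 hs
  have hch := Real.one_le_cosh s
  have hp := Real.pi_pos
  have h0 : 0 ≤ 2 * Real.pi * (Real.cosh s - 1) := mul_nonneg (by positivity) (by linarith)
  rw [volume_strip measurableSet_Icc hr, hball _ _ hs, hball _ _ hs, Real.volume_Icc,
    ← ENNReal.ofReal_mul hr, ← ENNReal.ofReal_add h0 h0,
    ← ENNReal.ofReal_add (mul_nonneg hr (by linarith)) (by linarith)]
  apply ENNReal.ofReal_le_ofReal
  linarith

lemma slice_lower {γ : ℝ → ℍ} (hγ : Isometry γ) {r s : ℝ} (hr : 0 ≤ r) (hs : 0 ≤ s) :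
    ENNReal.ofReal (2 * r * Real.sinh s) ≤
      volume {z : ℍ | Metric.infDist z (γ '' Icc 0 r) < s} := by
  obtain ⟨g, hg⟩ := exists_SL_normalize hγ
  have hsub : (fun z => (g : GL (Fin 2) ℝ) • z) ⁻¹' (strip (Ioo (-Real.sinh s) (Real.sinh s)) r) ⊆
      {z : ℍ | Metric.infDist z (γ '' Icc 0 r) < s} := by
    intro z hz
    obtain ⟨t, ht, hd⟩ := tube_lower (z := g • z) hs hz
    rw [← hg, dist_smul] at hd
    exact (Metric.infDist_le_dist_of_mem (mem_image_of_mem γ ht)).trans_lt hd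
  refine le_trans ?_ (measure_mono hsub)
  rw [measure_preimage_smul, volume_strip measurableSet_Ioo hr, Real.volume_Ioo,
    ← ENNReal.ofReal_mul hr]
  apply ENNReal.ofReal_le_ofReal
  linarith

lemma main
    {Ω : Type*} [MeasurableSpace Ω] (P : Measure Ω) [IsProbabilityMeasure P]
    (μ : Measure UpperHalfPlane)
    (hμball : ∀ (x : UpperHalfPlane) (s : ℝ), 0 ≤ s →
      μ (Metric.closedBall x s) = ENNReal.ofReal (2 * Real.pi * (Real.cosh s - 1)))
    (lam : ℝ) (hlam : 0 < lam)
    (ν : Measure ℝ) [IsProbabilityMeasure ν] (hνpos : ν (Iio 0) = 0)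
    (hexp : ∫⁻ r, ENNReal.ofReal (Real.exp r) ∂ν < ∞)
    (ξ : Ω → Set (UpperHalfPlane × ℝ))
    (hvoid : ∀ A : Set (UpperHalfPlane × ℝ), MeasurableSet A → (μ.prod ν) A < ∞ →
      P {ω | ξ ω ∩ A = ∅} = ENNReal.ofReal (Real.exp (-(lam * ((μ.prod ν) A).toReal))))
    (V : Ω → Set UpperHalfPlane)
    (hV : ∀ ω, V ω = closure ((⋃ p ∈ ξ ω, Metric.closedBall p.1 p.2)ᶜ))
    (γ : ℝ → UpperHalfPlane) (hγ : Isometry γ)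
    (f : ℝ → ℝ≥0∞) (hf : ∀ r, f r = P {ω | γ '' Icc 0 r ⊆ V ω}) :
    ∃ c₁ c₂ : ℝ, 0 < c₁ ∧ 0 < c₂ ∧ ∀ r : ℝ, 1 ≤ r →
      c₁ * Real.exp (-(2 * lam * ∫ s, Real.sinh s ∂ν) * r) ≤ (f r).toReal ∧
      (f r).toReal ≤ c₂ * Real.exp (-(2 * lam * ∫ s, Real.sinh s ∂ν) * r) := by
  obtain rfl := eq_volume hμball
  have hνae : ∀ᵐ s ∂ν, 0 ≤ s := by
    rw [ae_iff]; simpa [Iio, not_le] using hνpos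
  have hIexp : Integrable (fun s : ℝ => Real.exp s) ν := by
    refine ⟨Real.continuous_exp.aestronglyMeasurable, ?_⟩
    rw [hasFiniteIntegral_iff_ofReal (Eventually.of_forall fun s => (Real.exp_pos s).le)]
    exact hexp
  have hIsinh : Integrable (fun s : ℝ => Real.sinh s) ν := by
    refine hIexp.mono' Real.continuous_sinh.aestronglyMeasurable ?_
    filter_upwards [hνae] with s hs
    rw [Real.norm_eq_abs, abs_of_nonneg (Real.sinh_nonneg_iff.2 hs), ← Real.cosh_add_sinh]
    linarith [Real.cosh_pos s]
  have hIcosh : Integrable (fun s : ℝ => Real.cosh s) ν := by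
    refine hIexp.mono' Real.continuous_cosh.aestronglyMeasurable ?_
    filter_upwards [hνae] with s hs
    rw [Real.norm_eq_abs, abs_of_pos (Real.cosh_pos s), ← Real.cosh_add_sinh]
    linarith [Real.sinh_nonneg_iff.2 hs]
  set m := ∫ s, Real.sinh s ∂ν with hm
  set D := ∫ s, 4 * Real.pi * (Real.cosh s - 1) ∂ν with hD
  have hID : Integrable (fun s : ℝ => 4 * Real.pi * (Real.cosh s - 1)) ν :=
    (hIcosh.sub (integrable_const 1)).const_mul _
  have hD0 : 0 ≤ D := integral_nonneg fun s => by
    have := Real.one_le_cosh s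
    exact mul_nonneg (by positivity) (by linarith)
  have hm0 : 0 ≤ m := integral_nonneg_of_ae (by
    filter_upwards [hνae] with s hs using Real.sinh_nonneg_iff.2 hs)
  refine ⟨Real.exp (-(lam * D)), 1, Real.exp_pos _, one_pos, fun r hr1 => ?_⟩
  have hr : 0 ≤ r := by linarith
  have hK : IsCompact (γ '' Icc 0 r) := isCompact_Icc.image hγ.continuous
  have hne : (γ '' Icc 0 r).Nonempty := (nonempty_Icc.2 hr).image _
  set K := γ '' Icc 0 r
  have hcd : Continuous (fun p : ℍ × ℝ => Metric.infDist p.1 K) :=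
    (Metric.continuous_infDist_pt K).comp continuous_fst
  let A : Set (ℍ × ℝ) := {p | Metric.infDist p.1 K ≤ p.2}
  let B : Set (ℍ × ℝ) := {p | Metric.infDist p.1 K < p.2}
  have hAm : MeasurableSet A := (isClosed_le hcd continuous_snd).measurableSet
  have hBm : MeasurableSet B := (isOpen_lt hcd continuous_snd).measurableSet
  have hA : ((volume : Measure ℍ).prod ν) A ≤ ENNReal.ofReal (2 * r * m + D) := by
    rw [Measure.prod_apply_symm hAm]
    calc _ ≤ ∫⁻ s, ENNReal.ofReal (2 * r * Real.sinh s + 4 * Real.pi * (Real.cosh s - 1)) ∂ν := by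
          refine lintegral_mono_ae ?_
          filter_upwards [hνae] with s hs using slice_upper hγ hr hs hμball
      _ = _ := by
          have hsum : Integrable (fun s : ℝ => 2 * r * Real.sinh s +
              4 * Real.pi * (Real.cosh s - 1)) ν := (hIsinh.const_mul _).add hID
          rw [← ofReal_integral_eq_lintegral_ofReal hsum, integral_add
            (hIsinh.const_mul _) hID, integral_const_mul]
          filter_upwards [hνae] with s hs
          have h1 := Real.one_le_cosh s
          have h2 := Real.sinh_nonneg_iff.2 hs
          have h3 : 0 ≤ 4 * Real.pi * (Real.cosh s - 1) := mul_nonneg (by positivity) (by linarith)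
          simp only [Pi.zero_apply]; positivity
  have hB : ENNReal.ofReal (2 * r * m) ≤ ((volume : Measure ℍ).prod ν) B := by
    rw [Measure.prod_apply_symm hBm]
    calc _ = ∫⁻ s, ENNReal.ofReal (2 * r * Real.sinh s) ∂ν := by
          rw [← ofReal_integral_eq_lintegral_ofReal (hIsinh.const_mul _), integral_const_mul]
          filter_upwards [hνae] with s hs
          have h2 := Real.sinh_nonneg_iff.2 hs
          simp only [Pi.zero_apply]; positivity
      _ ≤ _ := by
          refine lintegral_mono_ae ?_
          filter_upwards [hνae] with s hs using slice_lower hγ hr hs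
  have hAfin : ((volume : Measure ℍ).prod ν) A < ∞ := hA.trans_lt ENNReal.ofReal_lt_top
  have hBfin : ((volume : Measure ℍ).prod ν) B < ∞ :=
    (measure_mono (show B ⊆ A from fun p hp =>
      le_of_lt (show Metric.infDist p.1 K < p.2 from hp))).trans_lt hAfin
  have hftop : f r ≠ ∞ := by rw [hf]; exact measure_ne_top _ _
  constructor
  · have h1 : P {ω | ξ ω ∩ A = ∅} ≤ f r := by
      rw [hf]
      refine measure_mono fun ω hω => ?_
      rw [mem_ofPred_eq, hV]
      refine Subset.trans (fun z hz => ?_) subset_closure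
      intro hmem
      simp only [mem_iUnion] at hmem
      obtain ⟨p, hp, hzp⟩ := hmem
      have : p ∈ ξ ω ∩ A := ⟨hp, (Metric.infDist_le_dist_of_mem hz).trans
        (by rw [dist_comm]; exact hzp)⟩
      rw [mem_ofPred_eq] at hω
      rw [hω] at this
      exact this
    rw [hvoid A hAm hAfin] at h1
    have h2 := ENNReal.toReal_mono hftop h1
    rw [ENNReal.toReal_ofReal (Real.exp_pos _).le] at h2
    refine le_trans ?_ h2
    rw [← Real.exp_add, Real.exp_le_exp]
    have h3 : (((volume : Measure ℍ).prod ν) A).toReal ≤ 2 * r * m + D :=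
      ENNReal.toReal_le_of_le_ofReal (by positivity) hA
    nlinarith
  · have h1 : f r ≤ P {ω | ξ ω ∩ B = ∅} := by
      rw [hf]
      refine measure_mono fun ω hω => ?_
      rw [mem_ofPred_eq, hV] at hω
      rw [mem_ofPred_eq, eq_empty_iff_forall_notMem]
      rintro p ⟨hp, hpB⟩
      obtain ⟨z, hz, hd⟩ := (Metric.infDist_lt_iff hne).1 hpB
      have hz' : z ∈ Metric.ball p.1 p.2 := by rw [Metric.mem_ball, dist_comm]; exact hd
      obtain ⟨w, hw1, hw2⟩ := mem_closure_iff.1 (hω hz) _ Metric.isOpen_ball hz'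
      exact hw2 (mem_biUnion hp (Metric.ball_subset_closedBall hw1))
    rw [hvoid B hBm hBfin] at h1
    have h2 := ENNReal.toReal_mono ENNReal.ofReal_ne_top h1
    rw [ENNReal.toReal_ofReal (Real.exp_pos _).le] at h2
    refine h2.trans ?_
    rw [one_mul, Real.exp_le_exp]
    have h3 : 2 * r * m ≤ (((volume : Measure ℍ).prod ν) B).toReal :=
      (ENNReal.ofReal_le_iff_le_toReal hBfin.ne).1 hB
    nlinarith

end VacantAux

/-- the vacant phase of the hyperbolic Poisson Boolean model with
i.i.d. random radii. Let `ξ` be a marked Poisson process in the hyperbolic plane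
with intensity `λ μ ⊗ ν`, where `μ` is the hyperbolic area measure and `ν` is the
law of the radius `R`, satisfying `E[e^R] < ∞`. Then the vacant phase `V` has
`α`-value `α = 2 λ E[sinh R]`: the probability that a geodesic segment of length
`r` lies in `V` is `Θ(exp(−2 λ E[sinh R] · r))`. -/
theorem vacant_phase_random_radii_alpha_value
    [MeasurableSpace UpperHalfPlane] [BorelSpace UpperHalfPlane]
    {Ω : Type*} [MeasurableSpace Ω] (P : Measure Ω) [IsProbabilityMeasure P]
    (μ : Measure UpperHalfPlane)
    (hμinv : ∀ φ : UpperHalfPlane ≃ᵢ UpperHalfPlane, μ.map φ = μ)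
    (hμball : ∀ (x : UpperHalfPlane) (s : ℝ), 0 ≤ s →
      μ (Metric.closedBall x s) = ENNReal.ofReal (2 * Real.pi * (Real.cosh s - 1)))
    (lam : ℝ) (hlam : 0 < lam)
    -- the law ν of the random radius, with finite exponential moment E[e^R] < ∞
    (ν : Measure ℝ) [IsProbabilityMeasure ν] (hνpos : ν (Iio 0) = 0)
    (hexp : ∫⁻ r, ENNReal.ofReal (Real.exp r) ∂ν < ∞)
    -- the marked Poisson process of centers and radii, via its void probabilities
    (ξ : Ω → Set (UpperHalfPlane × ℝ))
    (hξmeas : ∀ A : Set (UpperHalfPlane × ℝ), MeasurableSet A →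
      MeasurableSet {ω | ξ ω ∩ A = ∅})
    (hvoid : ∀ A : Set (UpperHalfPlane × ℝ), MeasurableSet A → (μ.prod ν) A < ∞ →
      P {ω | ξ ω ∩ A = ∅} = ENNReal.ofReal (Real.exp (-(lam * ((μ.prod ν) A).toReal))))
    -- the vacant region V of the Boolean model with random radii
    (V : Ω → Set UpperHalfPlane)
    (hV : ∀ ω, V ω = closure ((⋃ p ∈ ξ ω, Metric.closedBall p.1 p.2)ᶜ))
    -- a fixed geodesic line and f(r) = P(segment of length r ⊆ V)
    (γ : ℝ → UpperHalfPlane) (hγ : Isometry γ)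
    (f : ℝ → ℝ≥0∞) (hf : ∀ r, f r = P {ω | γ '' Icc 0 r ⊆ V ω}) :
    ∃ c₁ c₂ : ℝ, 0 < c₁ ∧ 0 < c₂ ∧ ∀ r : ℝ, 1 ≤ r →
      c₁ * Real.exp (-(2 * lam * ∫ s, Real.sinh s ∂ν) * r) ≤ (f r).toReal ∧
      (f r).toReal ≤ c₂ * Real.exp (-(2 * lam * ∫ s, Real.sinh s ∂ν) * r) := by
  obtain rfl : ‹MeasurableSpace UpperHalfPlane› = UpperHalfPlane.instMeasurableSpace := by
    rw [BorelSpace.measurable_eq (α := UpperHalfPlane)]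
    exact (@BorelSpace.measurable_eq UpperHalfPlane _ UpperHalfPlane.instMeasurableSpace _).symm
  exact VacantAux.main P μ hμball lam hlam ν hνpos hexp ξ hvoid V hV γ hγ f hf
end
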